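/- In a minimal counterexample (G, S, R, v, P_k(v), Q, k) to the Extension Theorem, every vertex u ∈ V(G) − S − R has degree 3 and is adjacent to exactly 3 distinct vertices. -/

import Mathlib

/-!
Multigraphs are modelled by a vertex type `V`, an edge type `E`, and an
incidence map `ends : E → Sym2 V` giving the (unordered) pair of endpoints
of each edge.  Subgraphs are identified with their edge sets (`Set E`).
-/

namespace SteinerPacking

variable {V E : Type}

/-- The set of edges incident to a vertex `u` (denoted `E(u)` in the paper). -/
def incEdges (ends : E → Sym2 V) (u : V) : Set E := {e | u ∈ ends e}

/-- The degree `d(u) = |E(u)|` of a vertex. -/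
noncomputable def deg (ends : E → Sym2 V) (u : V) : ℕ := (incEdges ends u).ncard

/-- One step along an edge of the edge set `F`. -/
def Step (ends : E → Sym2 V) (F : Set E) (a b : V) : Prop := ∃ e ∈ F, ends e = s(a, b)

/-- `a` and `b` are joined by a walk using only edges in `F`. -/
def Reaches (ends : E → Sym2 V) (F : Set E) (a b : V) : Prop :=
  Relation.ReflTransGen (Step ends F) a b

/-- The vertex set `S` is connected in the subgraph with edge set `F`. -/
def ConnectsSet (ends : E → Sym2 V) (F : Set E) (S : Set V) : Prop :=
  ∀ a ∈ S, ∀ b ∈ S, Reaches ends F a b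

/-- A walk from `u` to `w` given by a list of edges. -/
inductive IsWalk (ends : E → Sym2 V) : V → V → List E → Prop
  | nil (v : V) : IsWalk ends v v []
  | cons {u v w : V} {e : E} {l : List E} :
      ends e = s(u, v) → IsWalk ends v w l → IsWalk ends u w (e :: l)

/-- A path from `u` to `v` using edges of `F` (a walk with no repeated edges). -/
def IsPathIn (ends : E → Sym2 V) (F : Set E) (u v : V) (l : List E) : Prop :=
  IsWalk ends u v l ∧ l.Nodup ∧ ∀ e ∈ l, e ∈ F

/-- There are `n` pairwise edge-disjoint paths from `u` to `v` inside `F`. -/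
def EdgeDisjointPathsIn (ends : E → Sym2 V) (F : Set E) (n : ℕ) (u v : V) : Prop :=
  ∃ P : Fin n → List E, (∀ i, IsPathIn ends F u v (P i)) ∧
    ∀ i j, i ≠ j → ∀ e ∈ P i, e ∉ P j

/-- `S` is `n`-edge-connected in the (sub)graph with edge set `F`:
any two distinct vertices of `S` are joined by `n` edge-disjoint paths. -/
def EdgeConnectedIn (ends : E → Sym2 V) (F : Set E) (S : Set V) (n : ℕ) : Prop :=
  ∀ a ∈ S, ∀ b ∈ S, a ≠ b → EdgeDisjointPathsIn ends F n a b

/-- A family of subgraphs (edge sets) is pairwise edge-disjoint. -/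
def PairwiseEdgeDisjoint {k : ℕ} (H : Fin k → Set E) : Prop :=
  ∀ i j, i ≠ j → Disjoint (H i) (H j)

/-- `v` is a cut vertex of the subgraph with edge set `H`: some two vertices
distinct from `v` are connected in `H` but not after removing `v`. -/
def IsCutVertexOf (ends : E → Sym2 V) (H : Set E) (v : V) : Prop :=
  ∃ a b : V, a ≠ v ∧ b ≠ v ∧ Reaches ends H a b ∧
    ¬ Reaches ends {e ∈ H | v ∉ ends e} a b

/-- A subpartition of `E(v)` into `k` (possibly empty) parts. -/
def IsSubpartitionAt {k : ℕ} (ends : E → Sym2 V) (v : V) (P : Fin k → Set E) : Prop :=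
  (∀ i, P i ⊆ incEdges ends v) ∧ ∀ i j, i ≠ j → Disjoint (P i) (P j)

/-- A balanced partition of `E(v)` into `k` parts: each part has ≥ 2 edges. -/
def IsBalancedPartitionAt {k : ℕ} (ends : E → Sym2 V) (v : V) (P : Fin k → Set E) : Prop :=
  IsSubpartitionAt ends v P ∧ (⋃ i, P i) = incEdges ends v ∧ ∀ i, 2 ≤ (P i).ncard

/-- A balanced subpartition of `E(v)`: one extendable to a balanced partition. -/
def IsBalancedSubpartitionAt {k : ℕ} (ends : E → Sym2 V) (v : V) (P : Fin k → Set E) : Prop :=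
  IsSubpartitionAt ends v P ∧
    ∃ P' : Fin k → Set E, IsBalancedPartitionAt ends v P' ∧ ∀ i, P i ⊆ P' i

/-- The subgraphs `H 1, …, H k` extend the subpartition `P` at `v`:
`P i ⊆ H i` and `v` is not a cut vertex of any `H i`. -/
def Extend {k : ℕ} (ends : E → Sym2 V) (v : V) (P H : Fin k → Set E) : Prop :=
  ∀ i, P i ⊆ H i ∧ ¬ IsCutVertexOf ends (H i) v

/-- The subgraphs `H 1, …, H k` balance the vertex `u`. -/
def BalanceVertex {k : ℕ} (ends : E → Sym2 V) (H : Fin k → Set E) (u : V) : Prop :=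
  IsBalancedSubpartitionAt ends u (fun i => incEdges ends u ∩ H i)

/-- The subgraphs `H 1, …, H k` balance every vertex of `T`. -/
def BalanceSet {k : ℕ} (ends : E → Sym2 V) (H : Fin k → Set E) (T : Set V) : Prop :=
  ∀ u ∈ T, BalanceVertex ends H u

/-- A loopless multigraph. -/
def Loopless (ends : E → Sym2 V) : Prop := ∀ e : E, ¬ (ends e).IsDiag

/-- The set of neighbors of a vertex. -/
def neighbors (ends : E → Sym2 V) (u : V) : Set V := {w | ∃ e, ends e = s(u, w)}

/-- There is no family of `k` pairwise edge-disjoint `S`-subgraphs that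
balance `S ∪ R` and extend the subpartition `P` at `v`. -/
def NoGoodPacking {k : ℕ} (ends : E → Sym2 V) (S R : Set V) (v : V)
    (P : Fin k → Set E) : Prop :=
  ¬ ∃ H : Fin k → Set E, PairwiseEdgeDisjoint H ∧ (∀ i, ConnectsSet ends (H i) S) ∧
      BalanceSet ends H (S ∪ R) ∧ Extend ends v P H

/-- `(G, S, R, v, P, Q, k)` is a counterexample to the Extension Theorem:
it satisfies all hypotheses of the Extension Theorem (including that every
label appears at least twice at `v`), yet admits no good packing. -/
def ExtCex (Q k : ℕ) (ends : E → Sym2 V) (S R : Set V) (v : V)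
    (P : Fin k → Set E) : Prop :=
  36 ≤ Q ∧ 0 < k ∧ Disjoint S R ∧ 2 ≤ S.ncard ∧
  EdgeConnectedIn ends Set.univ S (Q * k) ∧
  (∀ r ∈ R, (Q - 2) * k ≤ deg ends r) ∧
  v ∈ S ∧ (∀ e : E, v ∈ ends e → ¬ (ends e).IsDiag) ∧
  deg ends v = Q * k ∧
  IsBalancedSubpartitionAt ends v P ∧ (∀ i, 2 ≤ (P i).ncard) ∧
  NoGoodPacking ends S R v P

/-- The measure used for minimality: number of vertices plus number of
non-loop edges. -/
noncomputable def extMeasure (ends : E → Sym2 V) : ℕ :=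
  Nat.card V + {e : E | ¬ (ends e).IsDiag}.ncard

/-- A minimal counterexample to the Extension Theorem: a counterexample whose
measure is at most the measure of every counterexample (with the same `Q`, `k`). -/
def MinExtCex (Q k : ℕ) (ends : E → Sym2 V) (S R : Set V) (v : V)
    (P : Fin k → Set E) : Prop :=
  ExtCex Q k ends S R v P ∧
  ∀ (V' E' : Type) (_ : Finite V') (_ : Finite E') (ends' : E' → Sym2 V')
    (S' R' : Set V') (v' : V') (P' : Fin k → Set E'),
    ExtCex Q k ends' S' R' v' P' → extMeasure ends ≤ extMeasure ends'

section Packing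

open Finset
open scoped Classical

/-- A rank function of a (poly)matroid with unit increments, on finite sets. -/
structure IsRank {Ω : Type} (r : Finset Ω → ℕ) : Prop where
  mono : ∀ A B, A ⊆ B → r A ≤ r B
  insert_le : ∀ A e, r (insert e A) ≤ r A + 1
  submod : ∀ A B, r (A ∩ B) + r (A ∪ B) ≤ r A + r B

lemma IsRank.contract {Ω : Type} {r : Finset Ω → ℕ} (h : IsRank r) (e : Ω) :
    IsRank (fun A => r (insert e A) - r {e}) := by
  have key : ∀ A, r {e} ≤ r (insert e A) := fun A => h.mono _ _ (by simp)
  refine ⟨fun A B hAB => ?_, fun A f => ?_, fun A B => ?_⟩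
  · have := h.mono (insert e A) (insert e B) (insert_subset_insert _ hAB)
    omega
  · have := h.insert_le (insert e A) f
    rw [Finset.insert_comm] at this
    have := key A
    omega
  · have := h.submod (insert e A) (insert e B)
    rw [← insert_inter_distrib, ← insert_union_distrib] at this
    have := key A
    have := key B
    have := key (A ∩ B)
    have := key (A ∪ B)
    omega

/-- Matroid intersection, for rank functions. -/
theorem exists_common_independent {Ω : Type} (E : Finset Ω) :
    ∀ (r₁ r₂ : Finset Ω → ℕ) (n : ℕ), IsRank r₁ → IsRank r₂ →
      r₁ ∅ = 0 → r₂ ∅ = 0 →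
      (∀ A ⊆ E, n ≤ r₁ A + r₂ (E \ A)) →
      ∃ I ⊆ E, I.card = n ∧ r₁ I = n ∧ r₂ I = n := by
  induction E using Finset.induction_on with
  | empty =>
    intro r₁ r₂ n _ _ h1 h2 h
    have := h ∅ (by simp)
    simp only [sdiff_self, h1] at this
    have h0 : r₂ (∅ \ ∅) = 0 := by simpa using h2
    refine ⟨∅, by simp, ?_⟩
    simp only [card_empty, h1, h2]
    simp at h0
    have : n = 0 := by
      have := h ∅ (by simp)
      simp [h1, h2] at this
      exact this
    omega
  | insert e E he ih =>
    intro r₁ r₂ n hr1 hr2 h1 h2 h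
    have hsd : ∀ A ⊆ E, insert e E \ insert e A = E \ A := by
      intro A hA
      ext x
      simp only [mem_sdiff, mem_insert]
      constructor
      · rintro ⟨rfl | hx, hx'⟩
        · simp at hx'
        · exact ⟨hx, fun h => hx' (Or.inr h)⟩
      · rintro ⟨hx, hx'⟩
        refine ⟨Or.inr hx, ?_⟩
        rintro (rfl | h)
        · exact he hx
        · exact hx' h
    have hsd' : ∀ A ⊆ E, insert e E \ A = insert e (E \ A) := by
      intro A hA
      ext x
      simp only [mem_sdiff, mem_insert]
      constructor
      · rintro ⟨rfl | hx, hx'⟩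
        · simp
        · exact Or.inr ⟨hx, hx'⟩
      · rintro (rfl | ⟨hx, hx'⟩)
        · exact ⟨Or.inl rfl, fun h => he (hA h)⟩
        · exact ⟨Or.inr hx, hx'⟩
    by_cases hdel : ∀ A ⊆ E, n ≤ r₁ A + r₂ (E \ A)
    · obtain ⟨I, hI, h⟩ := ih r₁ r₂ n hr1 hr2 h1 h2 hdel
      exact ⟨I, hI.trans (subset_insert _ _), h⟩
    push Not at hdel
    obtain ⟨A, hA, hAn⟩ := hdel
    have e1 : r₁ {e} = 1 := by
      have hle := hr1.insert_le ∅ e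
      by_contra hne
      have h0 : r₁ {e} = 0 := by
        simp only [insert_empty_eq] at hle
        omega
      have hs := hr1.submod A {e}
      have : A ∩ {e} = ∅ := by
        ext x
        simp only [mem_inter, mem_singleton, notMem_empty, iff_false]
        rintro ⟨hx, rfl⟩
        exact he (hA hx)
      rw [this, h1, h0, union_comm, ← insert_eq] at hs
      have := h (insert e A) (insert_subset_insert _ hA)
      rw [hsd A hA] at this
      omega
    have e2 : r₂ {e} = 1 := by
      have hle := hr2.insert_le ∅ e
      by_contra hne
      have h0 : r₂ {e} = 0 := by
        simp only [insert_empty_eq] at hle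
        omega
      have hs := hr2.submod (E \ A) {e}
      have : (E \ A) ∩ {e} = ∅ := by
        ext x
        simp only [mem_inter, mem_singleton, notMem_empty, iff_false, mem_sdiff]
        rintro ⟨⟨hx, _⟩, rfl⟩
        exact he hx
      rw [this, h2, h0, union_comm, ← insert_eq] at hs
      have := h A (hA.trans (subset_insert _ _))
      rw [hsd' A hA] at this
      omega
    have pos : 1 ≤ n := by omega
    have hcon : ∀ B ⊆ E, n - 1 ≤ (r₁ (insert e B) - r₁ {e}) +
        (r₂ (insert e (E \ B)) - r₂ {e}) := by
      intro B hB
      by_contra hlt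
      have m1 := hr1.mono {e} (insert e B) (by simp)
      have m2 := hr2.mono {e} (insert e (E \ B)) (by simp)
      have s1 := hr1.submod A (insert e B)
      have s2 := hr2.submod (E \ A) (insert e (E \ B))
      have t1 := h (A ∩ B) ((inter_subset_left.trans hA).trans (subset_insert _ _))
      have t2 := h (insert e (A ∪ B)) (insert_subset_insert _ (union_subset hA hB))
      rw [hsd _ (union_subset hA hB)] at t2
      rw [hsd' _ (inter_subset_left.trans hA)] at t1
      have i1 : A ∩ insert e B = A ∩ B := by
        ext x
        simp only [mem_inter, mem_insert]
        constructor
        · rintro ⟨hx, rfl | hx'⟩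
          · exact absurd (hA hx) he
          · exact ⟨hx, hx'⟩
        · rintro ⟨hx, hx'⟩
          exact ⟨hx, Or.inr hx'⟩
      have i2 : A ∪ insert e B = insert e (A ∪ B) := by
        ext x
        simp only [mem_union, mem_insert]
        tauto
      have i3 : (E \ A) ∩ insert e (E \ B) = E \ (A ∪ B) := by
        ext x
        simp only [mem_inter, mem_sdiff, mem_insert, mem_union]
        constructor
        · rintro ⟨⟨hx, hx'⟩, rfl | ⟨_, hx''⟩⟩
          · exact absurd hx he
          · tauto
        · tauto
      have i4 : (E \ A) ∪ insert e (E \ B) = insert e (E \ (A ∩ B)) := by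
        ext x
        simp only [mem_inter, mem_sdiff, mem_insert, mem_union]
        tauto
      rw [i1, i2] at s1
      rw [i3, i4] at s2
      omega
    obtain ⟨I, hI, hc, hI1, hI2⟩ := ih _ _ (n - 1) (hr1.contract e) (hr2.contract e)
      (by simp) (by simp) hcon
    have heI : e ∉ I := fun h => he (hI h)
    refine ⟨insert e I, insert_subset_insert _ hI, ?_, ?_, ?_⟩
    · rw [card_insert_of_notMem heI]
      omega
    · have := hr1.mono {e} (insert e I) (by simp)
      omega
    · have := hr2.mono {e} (insert e I) (by simp)
      omega

lemma isRank_card_image {Ω H : Type} (f : Ω → H) :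
    IsRank (fun A : Finset Ω => (A.image f).card) := by
  refine ⟨fun A B h => card_le_card (image_subset_image h), fun A e => ?_, fun A B => ?_⟩
  · rw [image_insert]
    exact card_insert_le _ _
  · have := card_inter_add_card_union (A.image f) (B.image f)
    have h1 : ((A ∩ B).image f).card ≤ (A.image f ∩ B.image f).card :=
      card_le_card (image_inter_subset _ _ _)
    rw [image_union]
    omega

lemma isRank_finrank_span {Ω M : Type} [AddCommGroup M] [Module ℚ M] [FiniteDimensional ℚ M]
    (x : Ω → M) :
    IsRank (fun A : Finset Ω => Module.finrank ℚ (Submodule.span ℚ (x '' (A : Set Ω)))) := by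
  refine ⟨fun A B h => ?_, fun A e => ?_, fun A B => ?_⟩
  · exact Submodule.finrank_mono (Submodule.span_mono (Set.image_mono (by exact_mod_cast h)))
  · rw [coe_insert, Set.image_insert_eq, Submodule.span_insert]
    have h1 := Submodule.finrank_add_le_finrank_add_finrank
      (Submodule.span ℚ {x e}) (Submodule.span ℚ (x '' (A : Set Ω)))
    have h2 := finrank_span_le_card (R := ℚ) ({x e} : Set M)
    simp only [Set.toFinset_singleton, card_singleton] at h2
    omega
  · have h1 := Submodule.finrank_sup_add_finrank_inf_eq
      (Submodule.span ℚ (x '' (A : Set Ω))) (Submodule.span ℚ (x '' (B : Set Ω)))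
    rw [← Submodule.span_union, ← Set.image_union, ← coe_union] at h1
    have h2 : Submodule.span ℚ (x '' ((A ∩ B : Finset Ω) : Set Ω)) ≤
        Submodule.span ℚ (x '' (A : Set Ω)) ⊓ Submodule.span ℚ (x '' (B : Set Ω)) := by
      refine le_inf ?_ ?_ <;> exact Submodule.span_mono (Set.image_mono (by simp))
    have h3 := Submodule.finrank_mono h2
    omega

/-- Packing of connected spanning sub-hypergraphs of prescribed colours, together with `N` hyperedges
reserved at each vertex: the partition condition is sufficient. -/
theorem exists_hypergraph_packing {W H : Type} [Fintype W] [Fintype H] [Nonempty W] (k N : ℕ)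
    (vert : H → Set W) (col : H → Fin k → Prop)
    (hyp : ∀ (s : Fin k → Setoid W) (Z : Finset W),
      ∑ i, Fintype.card (Quotient (s i)) + N * Z.card ≤
        (univ.filter fun h => (∃ i, col h i ∧ ∃ a ∈ vert h, ∃ b ∈ vert h, ¬ (s i) a b) ∨
          ∃ w ∈ vert h, w ∈ Z).card + k) :
    ∃ g : H → Option (Fin k ⊕ W),
      (∀ h i, g h = some (Sum.inl i) → col h i) ∧
      (∀ h w, g h = some (Sum.inr w) → w ∈ vert h) ∧
      (∀ w, N ≤ (univ.filter fun h => g h = some (Sum.inr w)).card) ∧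
      (∀ i (Y : Set W), (∀ h, g h = some (Sum.inl i) → ∀ a ∈ vert h, ∀ b ∈ vert h, a ∈ Y → b ∈ Y) →
        ∀ a b, a ∈ Y → b ∈ Y) := by
  let J := (Fin k × W) ⊕ (W × Fin N)
  let Ω := H × ((Fin k × W × W) ⊕ (W × Fin N))
  let e : J → (J → ℚ) := fun t => Pi.single t 1
  let x : Ω → (J → ℚ) := fun ω => Sum.elim
    (fun t => e (Sum.inl (t.1, t.2.1)) - e (Sum.inl (t.1, t.2.2))) (fun t => e (Sum.inr t)) ω.2
  let adm : Ω → Prop := fun ω => Sum.elim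
    (fun t => col ω.1 t.1 ∧ t.2.1 ∈ vert ω.1 ∧ t.2.2 ∈ vert ω.1) (fun t => t.1 ∈ vert ω.1) ω.2
  let E : Finset Ω := univ.filter adm
  let r₁ : Finset Ω → ℕ := fun A => (A.image Prod.fst).card
  let r₂ : Finset Ω → ℕ := fun A => Module.finrank ℚ (Submodule.span ℚ (x '' (A : Set Ω)))
  let ann : Finset Ω → Submodule ℚ (Module.Dual ℚ (J → ℚ)) := fun A =>
    (Submodule.span ℚ (x '' (A : Set Ω))).dualAnnihilator
  have hdim : ∀ A, r₂ A + Module.finrank ℚ (ann A) =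
      k * Fintype.card W + Fintype.card W * N := by
    intro A
    have := Subspace.finrank_add_finrank_dualAnnihilator_eq
      (Submodule.span ℚ (x '' (A : Set Ω)))
    rw [Module.finrank_fintype_fun_eq_card] at this
    simpa [J] using this
  have hann : ∀ (A : Finset Ω) (ψ : Module.Dual ℚ (J → ℚ)),
      ψ ∈ ann A ↔ ∀ ω ∈ A, ψ (x ω) = 0 := by
    intro A ψ
    rw [Submodule.mem_dualAnnihilator]
    constructor
    · intro h ω hω
      exact h _ (Submodule.subset_span ⟨ω, by exact_mod_cast hω, rfl⟩)
    · intro h w hw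
      have : Submodule.span ℚ (x '' (A : Set Ω)) ≤ LinearMap.ker ψ := by
        rw [Submodule.span_le]
        rintro _ ⟨ω, hω, rfl⟩
        exact h ω (by exact_mod_cast hω)
      exact this hw
  have hext : ∀ ψ : Module.Dual ℚ (J → ℚ), (∀ t, ψ (e t) = 0) → ψ = 0 := by
    intro ψ h
    refine LinearMap.pi_ext' fun t => ?_
    ext
    simpa using h t
  have hWpos : 0 < Fintype.card W := Fintype.card_pos
  have hcond : ∀ A ⊆ E, k * (Fintype.card W - 1) + Fintype.card W * N ≤ r₁ A + r₂ (E \ A) := by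
    intro A hA
    set B := E \ A with hB
    let s : Fin k → Setoid W := fun i =>
      { r := fun a b => ∀ ψ ∈ ann B, ψ (e (Sum.inl (i, a))) = ψ (e (Sum.inl (i, b)))
        iseqv := ⟨fun a ψ _ => rfl, fun h ψ hψ => (h ψ hψ).symm,
          fun h h' ψ hψ => (h ψ hψ).trans (h' ψ hψ)⟩ }
    let U : Finset (W × Fin N) := univ.filter fun t => ∃ ψ ∈ ann B, ψ (e (Sum.inr t)) ≠ 0
    let Z : Finset W := U.image Prod.fst
    have hU : U.card ≤ N * Z.card := by
      refine card_le_mul_card_image U N fun w _ => ?_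
      have : (U.filter fun t => t.1 = w) ⊆ (univ : Finset (Fin N)).image fun j => (w, j) := by
        intro t ht
        rw [mem_filter] at ht
        simp only [mem_image, mem_univ, true_and]
        exact ⟨t.2, by rw [← ht.2]⟩
      refine (card_le_card this).trans (card_image_le.trans (by simp))
    have hs := hyp s Z
    have hsub : (univ.filter fun h => (∃ i, col h i ∧ ∃ a ∈ vert h, ∃ b ∈ vert h, ¬ (s i) a b) ∨
          ∃ w ∈ vert h, w ∈ Z) ⊆ A.image Prod.fst := by
      intro h hh
      rw [mem_filter] at hh
      rw [mem_image]
      rcases hh.2 with ⟨i, hc, a, ha, b, hb, hab⟩ | ⟨w, hw, hwZ⟩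
      · refine ⟨(h, Sum.inl (i, a, b)), ?_, rfl⟩
        by_contra hn
        apply hab
        intro ψ hψ
        have hm : (h, Sum.inl (i, a, b)) ∈ B := by
          rw [hB, mem_sdiff]
          exact ⟨by simp [E, adm, hc, ha, hb], hn⟩
        have := (hann B ψ).1 hψ _ hm
        simp only [x, Sum.elim_inl, map_sub] at this
        exact sub_eq_zero.1 this
      · obtain ⟨⟨w', j⟩, ht, rfl⟩ := mem_image.1 hwZ
        refine ⟨(h, Sum.inr (w', j)), ?_, rfl⟩
        by_contra hn
        obtain ⟨ψ, hψ, hne⟩ := (mem_filter.1 ht).2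
        apply hne
        have hm : (h, Sum.inr (w', j)) ∈ B := by
          rw [hB, mem_sdiff]
          exact ⟨by simpa [E, adm] using hw, hn⟩
        exact (hann B ψ).1 hψ _ hm
    have hr1 := card_le_card hsub
    let D := (Σ i, Quotient (s i)) ⊕ {t // t ∈ U}
    let T : ann B →ₗ[ℚ] (D → ℚ) := LinearMap.pi fun d =>
      (LinearMap.applyₗ (Sum.elim (fun q : Σ i, Quotient (s i) => e (Sum.inl (q.1, q.2.out)))
        (fun t => e (Sum.inr t.1)) d)).comp (ann B).subtype
    have hT : Function.Injective T := by
      rw [← LinearMap.ker_eq_bot, LinearMap.ker_eq_bot']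
      rintro ⟨ψ, hψ⟩ h0
      rw [Submodule.mk_eq_zero]
      apply hext
      rintro (⟨i, a⟩ | t)
      · have h1 := congrFun h0 (Sum.inl ⟨i, Quotient.mk (s i) a⟩)
        have h2 : (s i) (Quotient.mk (s i) a).out a := Quotient.mk_out a
        rw [← h2 ψ hψ]
        exact h1
      · by_contra hne
        have ht : t ∈ U := mem_filter.2 ⟨mem_univ _, ψ, hψ, hne⟩
        exact hne (congrFun h0 (Sum.inr ⟨t, ht⟩))
    have hfin := LinearMap.finrank_le_finrank_of_injective hT
    rw [Module.finrank_fintype_fun_eq_card] at hfin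
    have hD : Fintype.card D = ∑ i, Fintype.card (Quotient (s i)) + U.card := by
      simp [D]
    have h2 := hdim B
    have h3 : k * (Fintype.card W - 1) + k = k * Fintype.card W := by
      obtain ⟨m, hm⟩ : ∃ m, Fintype.card W = m + 1 := ⟨_, (Nat.succ_pred_eq_of_pos hWpos).symm⟩
      rw [hm]
      simp
      ring
    change _ ≤ (A.image Prod.fst).card + _
    omega
  obtain ⟨I, hIE, hIc, hI1, hI2⟩ := exists_common_independent E r₁ r₂
    (k * (Fintype.card W - 1) + Fintype.card W * N) (isRank_card_image _)
    (isRank_finrank_span x) (by simp [r₁]) (by simp [r₂])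
    (fun A hA => by convert hcond A hA)
  have hinj : Set.InjOn Prod.fst (I : Set Ω) := card_image_iff.1 (hI1.trans hIc.symm)
  have hannI : Module.finrank ℚ (ann I) = k := by
    have h2 := hdim I
    have h3 : k * (Fintype.card W - 1) + k = k * Fintype.card W := by
      obtain ⟨m, hm⟩ : ∃ m, Fintype.card W = m + 1 := ⟨_, (Nat.succ_pred_eq_of_pos hWpos).symm⟩
      rw [hm]
      simp
      ring
    omega
  let lin : (J → ℚ) → Module.Dual ℚ (J → ℚ) := fun F => Fintype.linearCombination ℚ F
  have hlin : ∀ F t, lin F (e t) = F t := by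
    intro F t
    simp [lin, e, Fintype.linearCombination_apply_single]
  let cst : Fin k → Module.Dual ℚ (J → ℚ) := fun i =>
    lin (Sum.elim (fun t => if t.1 = i then 1 else 0) (fun _ => 0))
  have hcst : ∀ (c : Fin k → ℚ) i a, (∑ j, c j • cst j) (e (Sum.inl (i, a))) = c i := by
    intro c i a
    simp only [LinearMap.sum_apply, LinearMap.smul_apply, cst, hlin]
    simp
  have hcst' : ∀ (c : Fin k → ℚ) t, (∑ j, c j • cst j) (e (Sum.inr t)) = 0 := by
    intro c t
    simp only [LinearMap.sum_apply, LinearMap.smul_apply, cst, hlin]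
    simp
  have hli : LinearIndependent ℚ cst := by
    rw [Fintype.linearIndependent_iff]
    intro c h i
    rw [← hcst c i (Classical.arbitrary W), h]
    rfl
  have hspan : Submodule.span ℚ (Set.range cst) = ann I := by
    refine Submodule.eq_of_le_of_finrank_eq ?_ ?_
    · rw [Submodule.span_le]
      rintro _ ⟨i, rfl⟩
      rw [SetLike.mem_coe, hann]
      rintro ⟨h, ⟨j, a, b⟩ | t⟩ _
      · simp [x, cst, hlin]
      · simp [x, cst, hlin]
    · rw [finrank_span_eq_card hli, hannI]
      simp
  have hann_cst : ∀ ψ ∈ ann I, ∃ c : Fin k → ℚ, ψ = ∑ j, c j • cst j := by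
    intro ψ hψ
    rw [← hspan] at hψ
    obtain ⟨c, hc⟩ := (Submodule.mem_span_range_iff_exists_fun ℚ).1 hψ
    exact ⟨c, hc.symm⟩
  let g : H → Option (Fin k ⊕ W) := fun h =>
    if hh : ∃ y, (h, y) ∈ I then some (Sum.map Prod.fst Prod.fst hh.choose) else none
  have hg : ∀ h y, (h, y) ∈ I → g h = some (Sum.map Prod.fst Prod.fst y) := by
    intro h y hy
    have hh : ∃ y, (h, y) ∈ I := ⟨y, hy⟩
    have h1 := hh.choose_spec
    have : (h, hh.choose) = (h, y) := hinj (mem_coe.2 h1) (mem_coe.2 hy) rfl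
    simp only [g, dif_pos hh]
    rw [(Prod.mk.inj this).2]
  have hg' : ∀ h z, g h = some z → ∃ y, (h, y) ∈ I ∧ z = Sum.map Prod.fst Prod.fst y := by
    intro h z hz
    by_cases hh : ∃ y, (h, y) ∈ I
    · obtain ⟨y, hy⟩ := hh
      rw [hg h y hy] at hz
      exact ⟨y, hy, (Option.some.inj hz).symm⟩
    · simp only [g, dif_neg hh] at hz
      exact absurd hz (by simp)
  have hadm : ∀ ω ∈ I, adm ω := fun ω h => (mem_filter.1 (hIE h)).2
  refine ⟨g, ?_, ?_, ?_, ?_⟩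
  · intro h i hi
    obtain ⟨⟨j, a, b⟩ | t, hy, hz⟩ := hg' h _ hi
    · have := hadm _ hy
      simp only [Sum.map_inl, Sum.inl.injEq] at hz
      rw [hz]
      exact this.1
    · simp at hz
  · intro h w hw
    obtain ⟨⟨j, a, b⟩ | t, hy, hz⟩ := hg' h _ hw
    · simp at hz
    · have := hadm _ hy
      simp only [Sum.map_inr, Sum.inr.injEq] at hz
      rw [hz]
      exact this
  · intro w
    have hex : ∀ j : Fin N, ∃ h, (h, Sum.inr (w, j)) ∈ I := by
      intro j
      by_contra hno
      push Not at hno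
      have hm : lin (Pi.single (Sum.inr (w, j)) 1) ∈ ann I := by
        rw [hann]
        rintro ⟨h, ⟨i, a, b⟩ | t⟩ hω
        · simp [x, hlin]
        · have : t ≠ (w, j) := by
            rintro rfl
            exact hno h hω
          simp only [x, Sum.elim_inr, hlin]
          exact Pi.single_eq_of_ne (fun h => this (Sum.inr.inj h)) _
      obtain ⟨c, hc⟩ := hann_cst _ hm
      have := hcst' c (w, j)
      rw [← hc, hlin] at this
      simp at this
    choose η hη using hex
    have hηinj : Function.Injective η := by
      intro j j' hjj
      have h1 := hη j
      rw [hjj] at h1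
      have h2 : (η j', (Sum.inr (w, j) : (Fin k × W × W) ⊕ (W × Fin N))) =
          (η j', Sum.inr (w, j')) := hinj (mem_coe.2 h1) (mem_coe.2 (hη j')) rfl
      simpa using h2
    calc N = ((univ : Finset (Fin N)).image η).card := by
            rw [card_image_of_injective _ hηinj]
            simp
      _ ≤ _ := by
            refine card_le_card ?_
            intro h hh
            obtain ⟨j, _, rfl⟩ := mem_image.1 hh
            rw [mem_filter]
            exact ⟨mem_univ _, by rw [hg _ _ (hη j)]; rfl⟩
  · intro i Y hY a b ha
    by_contra hb
    let F : J → ℚ := Sum.elim (fun t => if t.1 = i ∧ t.2 ∈ Y then 1 else 0) (fun _ => 0)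
    have hm : lin F ∈ ann I := by
      rw [hann]
      rintro ⟨h, ⟨j, a, b⟩ | t⟩ hω
      · have ha := hadm _ hω
        have h1 := hg _ _ hω
        simp only [x, Sum.elim_inl, map_sub, hlin, F]
        by_cases hj : j = i
        · subst hj
          have h2 := hY h h1 a ha.2.1 b ha.2.2
          have h3 := hY h h1 b ha.2.2 a ha.2.1
          have : a ∈ Y ↔ b ∈ Y := ⟨h2, h3⟩
          simp [this]
        · simp [hj]
      · simp [x, hlin, F]
    obtain ⟨c, hc⟩ := hann_cst _ hm
    have h1 := hcst c i a
    have h2 := hcst c i b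
    rw [← hc, hlin] at h1 h2
    simp [F, ha] at h1
    simp [F, hb] at h2
    rw [← h1] at h2
    simp at h2

end Packing

section Contraction

open Finset
open scoped Classical

variable {V E : Type}

/-- Some `k`-labelling extends the partial labelling `φ` and uses every label at least twice on `D`,
as long as there are enough unlabelled edges in `D`. -/
lemma exists_full_labelling {k : ℕ} (hk : 0 < k) (D : Finset E) :
    ∀ (n : ℕ) (φ : E → Option (Fin k)), (D.filter fun e => φ e = none).card = n →
      ∑ i, (2 - (D.filter fun e => φ e = some i).card) ≤ n →
      ∃ ℓ : E → Fin k, (∀ e i, φ e = some i → ℓ e = i) ∧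
        ∀ i, 2 ≤ (D.filter fun e => ℓ e = i).card := by
  intro n
  induction n with
  | zero =>
    intro φ h0 hs
    refine ⟨fun e => (φ e).getD ⟨0, hk⟩, fun e i h => by simp [h], fun i => ?_⟩
    have h1 : 2 - (D.filter fun e => φ e = some i).card = 0 := by
      have := (Finset.sum_eq_zero_iff).1 (Nat.le_zero.1 hs) i (mem_univ _)
      exact this
    have h2 : (D.filter fun e => φ e = some i) ⊆
        (D.filter fun e => (φ e).getD ⟨0, hk⟩ = i) := by
      intro e he
      rw [mem_filter] at he ⊢
      exact ⟨he.1, by simp [he.2]⟩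
    have := card_le_card h2
    change 2 ≤ (D.filter fun e => (φ e).getD ⟨0, hk⟩ = i).card
    omega
  | succ n ih =>
    intro φ hn hs
    obtain ⟨e, he⟩ : (D.filter fun e => φ e = none).Nonempty := by
      rw [← card_pos]
      omega
    rw [mem_filter] at he
    have hup : ∀ i, ((D.filter fun f => Function.update φ e (some i) f = none).card = n) := by
      intro i
      have : (D.filter fun f => Function.update φ e (some i) f = none) =
          (D.filter fun e => φ e = none).erase e := by
        ext f
        by_cases hf : f = e
        · subst hf
          simp
        · simp [hf]
      rw [this, card_erase_of_mem (mem_filter.2 he), hn]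
      rfl
    have hle : ∀ i j, (D.filter fun f => φ f = some j) ⊆
        (D.filter fun f => Function.update φ e (some i) f = some j) := by
      intro i j f hf
      rw [mem_filter] at hf ⊢
      refine ⟨hf.1, ?_⟩
      rw [Function.update_of_ne]
      · exact hf.2
      · rintro rfl
        rw [he.2] at hf
        simp at hf
    have main : ∃ i, ∑ j, (2 - (D.filter fun f => Function.update φ e (some i) f = some j).card)
        ≤ n := by
      by_cases hd : ∃ i, (D.filter fun f => φ f = some i).card < 2
      · obtain ⟨i, hi⟩ := hd
        refine ⟨i, ?_⟩
        have hlt : ∑ j, (2 - (D.filter fun f => Function.update φ e (some i) f = some j).card) <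
            ∑ j, (2 - (D.filter fun f => φ f = some j).card) := by
          refine sum_lt_sum (fun j _ => ?_) ⟨i, mem_univ _, ?_⟩
          · have := card_le_card (hle i j)
            omega
          · have : (D.filter fun f => φ f = some i).card <
                (D.filter fun f => Function.update φ e (some i) f = some i).card := by
              refine card_lt_card ⟨hle i i, fun h => ?_⟩
              have := h (mem_filter.2 ⟨he.1, by simp⟩ :
                e ∈ D.filter fun f => Function.update φ e (some i) f = some i)
              rw [mem_filter, he.2] at this
              simp at this
            omega
        omega
      · push Not at hd
        refine ⟨⟨0, hk⟩, ?_⟩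
        rw [sum_eq_zero]
        · omega
        · intro j _
          have := card_le_card (hle ⟨0, hk⟩ j)
          have := hd j
          omega
    obtain ⟨i, hi⟩ := main
    obtain ⟨ℓ, h1, h2⟩ := ih _ (hup i) hi
    refine ⟨ℓ, fun f j hf => h1 f j ?_, h2⟩
    rw [Function.update_of_ne]
    · exact hf
    · rintro rfl
      rw [he.2] at hf
      simp at hf

/-- With `n` further unlabelled edges, the partial labelling `φ` of `D` can be completed so that every
label occurs at least twice. -/
def Slack {k : ℕ} (φ : E → Option (Fin k)) (D : Finset E) (n : ℕ) : Prop :=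
  ∑ i, (2 - (D.filter fun e => φ e = some i).card) ≤ (D.filter fun e => φ e = none).card + n

lemma Slack.of_erase {k : ℕ} {φ ψ : E → Option (Fin k)} {D : Finset E} {n : ℕ}
    (h : Slack φ D n) (hψ : ∀ e ∈ D, ψ e = none ∨ ψ e = φ e) : Slack ψ D n := by
  unfold Slack at *
  have hcount : ∀ χ : E → Option (Fin k),
      ∑ i, (D.filter fun e => χ e = some i).card + (D.filter fun e => χ e = none).card = D.card := by
    intro χ
    have := card_eq_sum_card_fiberwise (s := D) (f := χ) (t := univ) (fun _ _ => by simp)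
    rw [this, Fintype.sum_option, add_comm]
  have h1 := hcount φ
  have h2 := hcount ψ
  have h3 : ∀ i, (D.filter fun e => ψ e = some i).card ≤ (D.filter fun e => φ e = some i).card := by
    intro i
    refine card_le_card fun e he => ?_
    rw [mem_filter] at he ⊢
    refine ⟨he.1, ?_⟩
    rcases hψ e he.1 with h | h
    · rw [he.2] at h
      simp at h
    · rw [← h, he.2]
  have h4 : ∑ i, (2 - (D.filter fun e => ψ e = some i).card) +
      ∑ i, (D.filter fun e => ψ e = some i).card ≤
      ∑ i, (2 - (D.filter fun e => φ e = some i).card) +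
      ∑ i, (D.filter fun e => φ e = some i).card := by
    rw [← sum_add_distrib, ← sum_add_distrib]
    refine sum_le_sum fun i _ => ?_
    have := h3 i
    omega
  omega

variable [Fintype E]

/-- The edges leaving the vertex set `X`, in the multigraph whose edge `e` joins `p e` and `q e`. -/
noncomputable def cut (p q : E → V) (X : Set V) : Finset E :=
  univ.filter fun e => ¬ (p e ∈ X ↔ q e ∈ X)

/-- The edges that are not loops. -/
noncomputable def proper (p q : E → V) : Finset E := univ.filter fun e => p e ≠ q e

lemma mem_cut {p q : E → V} {X : Set V} {e : E} : e ∈ cut p q X ↔ ¬ (p e ∈ X ↔ q e ∈ X) := by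
  simp [cut]

lemma mem_proper {p q : E → V} {e : E} : e ∈ proper p q ↔ p e ≠ q e := by
  simp [proper]

lemma mem_cut_singleton {p q : E → V} {x : V} {e : E} :
    e ∈ cut p q {x} ↔ p e ≠ q e ∧ (p e = x ∨ q e = x) := by
  rw [mem_cut, Set.mem_singleton_iff, Set.mem_singleton_iff]
  constructor
  · intro h
    refine ⟨fun h' => h (by rw [h']), ?_⟩
    tauto
  · rintro ⟨h, rfl | rfl⟩ h'
    · exact h (h'.1 rfl).symm
    · exact h (h'.2 rfl)

lemma cut_compl (p q : E → V) (X : Set V) : cut p q Xᶜ = cut p q X := by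
  ext e
  simp only [mem_cut, Set.mem_compl_iff, not_iff_not]

/-- The hypotheses of the Extension Theorem, in terms of edge cuts.  The number `c w` counts
additional edges at `w` which are available for balancing only. -/
structure ExtData (p q : E → V) (S R : Set V) (v : V) (L k : ℕ) (ℓ : E → Fin k) (c : V → ℕ) :
    Prop where
  pos : 0 < k
  big : 36 * k ≤ L
  root : v ∈ S
  two : ∃ s ∈ S, s ≠ v
  conn : ∀ X : Set V, (∃ s ∈ S, s ∈ X) → (∃ s ∈ S, s ∉ X) → L ≤ (cut p q X).card
  deg_root : (cut p q {v}).card = L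
  label : ∀ i, 2 ≤ ((cut p q {v}).filter fun e => ℓ e = i).card
  disj : ∀ r ∈ R, r ∉ S
  large : ∀ r ∈ R, L ≤ (cut p q {r}).card + c r + 2 * k

/-- The conclusion of the Extension Theorem, for the partial labelling `φ` recording which of the `k`
subgraphs an edge belongs to. -/
structure IsExt (p q : E → V) (S R : Set V) (v : V) {k : ℕ} (ℓ : E → Fin k) (c : V → ℕ)
    (φ : E → Option (Fin k)) : Prop where
  root : ∀ e ∈ cut p q {v}, φ e = some (ℓ e)
  balance : ∀ w, w ∈ S ∨ w ∈ R → w ≠ v → Slack φ (cut p q {w}) (c w)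
  conn : ∀ i (Y : Set V),
    (∀ e, φ e = some i → p e ≠ v → q e ≠ v → (p e ∈ Y ↔ q e ∈ Y)) →
    ∃ β : Prop, (∀ s ∈ S, s ≠ v → (s ∈ Y ↔ β)) ∧
      ∀ e ∈ cut p q {v}, φ e = some i → ∀ x, x = p e ∨ x = q e → x ≠ v → (x ∈ Y ↔ β)

/-- All Extension-Theorem data with fewer than `n` edges (loops not counted) have an extension. -/
def ExtBelow (V E : Type) [Fintype E] (n : ℕ) : Prop :=
  ∀ (p q : E → V) (S R : Set V) (v : V) (L k : ℕ) (ℓ : E → Fin k) (c : V → ℕ),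
    (proper p q).card < n → ExtData p q S R v L k ℓ c → ∃ φ, IsExt p q S R v ℓ c φ

section
variable {p q : E → V} {S R : Set V} {v : V} {L k : ℕ} {ℓ : E → Fin k} {c : V → ℕ}

lemma card_proper_comp_lt {f : V → V} {e : E} (he : p e ≠ q e) (hf : f (p e) = f (q e)) :
    (proper (f ∘ p) (f ∘ q)).card < (proper p q).card := by
  refine card_lt_card ⟨fun x hx => ?_, fun h => ?_⟩
  · rw [mem_proper] at hx ⊢
    intro h
    exact hx (by simp [h])
  · have := h (mem_proper.2 he)
    rw [mem_proper] at this
    exact this hf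

/-- Contracting both sides of a tight cut. -/
lemma ExtData.exists_of_tight (h : ExtData p q S R v L k ℓ c)
    (ih : ExtBelow V E (proper p q).card) {X : Set V} (hv : v ∉ X) (hX : ∃ s ∈ S, s ∈ X)
    (ht : (cut p q X).card = L) (hin : ∃ e, p e ≠ q e ∧ p e ∈ X ∧ q e ∈ X)
    (hout : ∃ e, p e ≠ q e ∧ p e ∉ X ∧ q e ∉ X) : ∃ φ, IsExt p q S R v ℓ c φ := by
  obtain ⟨x, hxS, hxX⟩ := hX
  have hxv : x ≠ v := fun h => hv (h ▸ hxX)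
  let f₁ : V → V := fun y => if y ∈ X then x else y
  have f₁in : ∀ y ∈ X, f₁ y = x := fun y hy => if_pos hy
  have f₁out : ∀ y, y ∉ X → f₁ y = y := fun y hy => if_neg hy
  have f₁eq : ∀ w, w ∉ X → ∀ y, f₁ y = w ↔ y = w := by
    intro w hw y
    by_cases hy : y ∈ X
    · rw [f₁in y hy]
      exact ⟨fun h => absurd (h ▸ hxX) hw, fun h => absurd (h ▸ hy) hw⟩
    · rw [f₁out y hy]
  have f₁x : ∀ y, f₁ y = x ↔ y ∈ X := by
    intro y
    by_cases hy : y ∈ X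
    · simp [f₁in y hy, hy]
    · rw [f₁out y hy]
      exact ⟨fun h => h ▸ hxX, fun h => absurd h hy⟩
  have pre₁ : ∀ w, w ∉ X → cut (f₁ ∘ p) (f₁ ∘ q) {w} = cut p q {w} := by
    intro w hw
    ext e
    simp only [mem_cut, Function.comp, Set.mem_singleton_iff, f₁eq w hw]
  have pre₁x : cut (f₁ ∘ p) (f₁ ∘ q) {x} = cut p q X := by
    ext e
    simp only [mem_cut, Function.comp, Set.mem_singleton_iff, f₁x]
  let c₁ : V → ℕ := fun w => if w ∈ X then 0 else c w
  obtain ⟨e, he, hep, heq⟩ := hin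
  obtain ⟨φ₁, hφ₁⟩ := ih (f₁ ∘ p) (f₁ ∘ q) (f₁ '' S) (R \ X) v L k ℓ c₁
    (card_proper_comp_lt he ((f₁in _ hep).trans (f₁in _ heq).symm))
    { pos := h.pos
      big := h.big
      root := ⟨v, h.root, f₁out v hv⟩
      two := ⟨x, ⟨x, hxS, f₁in x hxX⟩, hxv⟩
      conn := by
        rintro Y ⟨_, ⟨s, hs, rfl⟩, hsY⟩ ⟨_, ⟨t, ht, rfl⟩, htY⟩
        exact h.conn (f₁ ⁻¹' Y) ⟨s, hs, hsY⟩ ⟨t, ht, htY⟩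
      deg_root := by rw [pre₁ v hv, h.deg_root]
      label := by
        rw [pre₁ v hv]
        exact h.label
      disj := by
        rintro r ⟨hr, hrX⟩ ⟨s, hs, hsr⟩
        rw [f₁eq r hrX] at hsr
        exact h.disj r hr (hsr ▸ hs)
      large := by
        rintro r ⟨hr, hrX⟩
        rw [pre₁ r hrX]
        simpa [c₁, hrX] using h.large r hr }
  have hsl := hφ₁.balance x (Or.inl ⟨x, hxS, f₁in x hxX⟩) hxv
  rw [pre₁x] at hsl
  simp only [Slack, c₁, hxX, if_true, add_zero] at hsl
  obtain ⟨m, hm, hm'⟩ := exists_full_labelling h.pos (cut p q X) _ φ₁ rfl hsl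
  let f₂ : V → V := fun y => if y ∈ X then y else v
  have f₂in : ∀ y ∈ X, f₂ y = y := fun y hy => if_pos hy
  have f₂out : ∀ y, y ∉ X → f₂ y = v := fun y hy => if_neg hy
  have f₂eq : ∀ w ∈ X, ∀ y, f₂ y = w ↔ y = w := by
    intro w hw y
    by_cases hy : y ∈ X
    · rw [f₂in y hy]
    · rw [f₂out y hy]
      exact ⟨fun h => absurd (h ▸ hw) hv, fun h => absurd (h ▸ hw) hy⟩
  have f₂v : ∀ y, f₂ y = v ↔ y ∉ X := by
    intro y
    by_cases hy : y ∈ X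
    · rw [f₂in y hy]
      exact ⟨fun h => absurd (h ▸ hy) hv, fun h => absurd hy h⟩
    · simp [f₂out y hy, hy]
  have pre₂ : ∀ w ∈ X, cut (f₂ ∘ p) (f₂ ∘ q) {w} = cut p q {w} := by
    intro w hw
    ext e
    simp only [mem_cut, Function.comp, Set.mem_singleton_iff, f₂eq w hw]
  have pre₂v : cut (f₂ ∘ p) (f₂ ∘ q) {v} = cut p q X := by
    ext e
    simp only [mem_cut, Function.comp, Set.mem_singleton_iff, f₂v, not_iff_not]
  obtain ⟨e', he', hep', heq'⟩ := hout
  obtain ⟨φ₂, hφ₂⟩ := ih (f₂ ∘ p) (f₂ ∘ q) (f₂ '' S) (R ∩ X) v L k m c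
    (card_proper_comp_lt he' ((f₂out _ hep').trans (f₂out _ heq').symm))
    { pos := h.pos
      big := h.big
      root := ⟨v, h.root, f₂out v hv⟩
      two := ⟨x, ⟨x, hxS, f₂in x hxX⟩, hxv⟩
      conn := by
        rintro Y ⟨_, ⟨s, hs, rfl⟩, hsY⟩ ⟨_, ⟨t, ht, rfl⟩, htY⟩
        exact h.conn (f₂ ⁻¹' Y) ⟨s, hs, hsY⟩ ⟨t, ht, htY⟩
      deg_root := by rw [pre₂v, ht]
      label := by
        rw [pre₂v]
        exact hm'
      disj := by
        rintro r ⟨hr, hrX⟩ ⟨s, hs, hsr⟩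
        rw [f₂eq r hrX] at hsr
        exact h.disj r hr (hsr ▸ hs)
      large := by
        rintro r ⟨hr, hrX⟩
        rw [pre₂ r hrX]
        exact h.large r hr }
  have hroot₂ : ∀ e ∈ cut p q X, φ₂ e = some (m e) := fun e he => hφ₂.root e (pre₂v ▸ he)
  let φ : E → Option (Fin k) := fun e => if p e ∈ X ∧ q e ∈ X then φ₂ e else φ₁ e
  have φin : ∀ e, p e ∈ X → q e ∈ X → φ e = φ₂ e := fun e h h' => if_pos ⟨h, h'⟩
  have φout : ∀ e, ¬ (p e ∈ X ∧ q e ∈ X) → φ e = φ₁ e := fun e h => if_neg h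
  have hinX : ∀ w ∈ X, ∀ y ∈ S, y = w → w ∈ f₂ '' S := by
    rintro w hw y hy rfl
    exact ⟨y, hy, f₂in y hw⟩
  refine ⟨φ, ?_, ?_, ?_⟩
  · intro e he
    have h1 := hφ₁.root e (by rwa [pre₁ v hv])
    rw [φout, h1]
    rintro ⟨h2, h3⟩
    rw [mem_cut_singleton] at he
    rcases he.2 with h | h
    · exact hv (h ▸ h2)
    · exact hv (h ▸ h3)
  · intro w hw hwv
    by_cases hwX : w ∈ X
    · have h1 := hφ₂.balance w (hw.imp (fun h => ⟨w, h, f₂in w hwX⟩) (fun h => ⟨h, hwX⟩)) hwv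
      rw [pre₂ w hwX] at h1
      refine h1.of_erase fun e he => ?_
      by_cases h2 : p e ∈ X ∧ q e ∈ X
      · exact Or.inr (φin e h2.1 h2.2)
      · rw [φout e h2]
        have hc : e ∈ cut p q X := by
          rw [mem_cut]
          rw [mem_cut_singleton] at he
          rcases he.2 with h | h
          · rw [h] at h2 ⊢
            tauto
          · rw [h] at h2 ⊢
            tauto
        rw [hroot₂ e hc]
        cases h3 : φ₁ e with
        | none => exact Or.inl rfl
        | some i => exact Or.inr (by rw [hm e i h3])
    · have h1 := hφ₁.balance w (hw.imp (fun h => ⟨w, h, f₁out w hwX⟩) (fun h => ⟨h, hwX⟩)) hwv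
      rw [pre₁ w hwX] at h1
      simp only [c₁, hwX, if_false] at h1
      refine h1.of_erase fun e he => Or.inr (φout e ?_)
      rintro ⟨h2, h3⟩
      rw [mem_cut_singleton] at he
      rcases he.2 with h | h
      · exact hwX (h ▸ h2)
      · exact hwX (h ▸ h3)
  · intro i Y hY
    obtain ⟨β, hβ, hβe⟩ := hφ₂.conn i Y (by
      intro e he hp hq
      simp only [Function.comp, ne_eq, f₂v, not_not] at hp hq
      rw [Function.comp, Function.comp, f₂in _ hp, f₂in _ hq]
      refine hY e (by rw [φin e hp hq, he]) ?_ ?_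
      · exact fun h => hv (h ▸ hp)
      · exact fun h => hv (h ▸ hq))
    have hβc : ∀ e ∈ cut p q X, φ₁ e = some i → ∀ y, y = p e ∨ y = q e → y ∈ X →
        (y ∈ Y ↔ β) := by
      intro e he h1 y hy hyX
      refine hβe e (pre₂v ▸ he) (by rw [hroot₂ e he, hm e i h1]) y ?_ ?_
      · rcases hy with h | h
        · exact Or.inl (by rw [Function.comp, ← h, f₂in y hyX])
        · exact Or.inr (by rw [Function.comp, ← h, f₂in y hyX])
      · exact fun h => hv (h ▸ hyX)
    let Y₁ : Set V := {y | (y ∈ X → β) ∧ (y ∉ X → y ∈ Y)}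
    have Y₁in : ∀ y ∈ X, (f₁ y ∈ Y₁ ↔ β) := by
      intro y hy
      rw [f₁in y hy]
      simp [Y₁, hxX]
    have Y₁out : ∀ y, y ∉ X → (f₁ y ∈ Y₁ ↔ y ∈ Y) := by
      intro y hy
      rw [f₁out y hy]
      simp [Y₁, hy]
    obtain ⟨γ, hγ, hγe⟩ := hφ₁.conn i Y₁ (by
      intro e he hp hq
      simp only [Function.comp, ne_eq, f₁eq v hv] at hp hq
      simp only [Function.comp]
      by_cases h1 : p e ∈ X <;> by_cases h2 : q e ∈ X
      · rw [Y₁in _ h1, Y₁in _ h2]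
      · rw [Y₁in _ h1, Y₁out _ h2, ← hβc e (by rw [mem_cut]; tauto) he (p e) (Or.inl rfl) h1]
        exact hY e (by rw [φout e (by tauto), he]) hp hq
      · rw [Y₁out _ h1, Y₁in _ h2, ← hβc e (by rw [mem_cut]; tauto) he (q e) (Or.inr rfl) h2]
        exact hY e (by rw [φout e (by tauto), he]) hp hq
      · rw [Y₁out _ h1, Y₁out _ h2]
        exact hY e (by rw [φout e (by tauto), he]) hp hq)
    have hβγ : β ↔ γ := by
      rw [← Y₁in x hxX, f₁in x hxX]
      exact hγ x ⟨x, hxS, f₁in x hxX⟩ hxv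
    refine ⟨γ, ?_, ?_⟩
    · intro s hs hsv
      by_cases hsX : s ∈ X
      · rw [← hβγ]
        exact hβ s ⟨s, hs, f₂in s hsX⟩ hsv
      · rw [← Y₁out s hsX, f₁out s hsX]
        exact hγ s ⟨s, hs, f₁out s hsX⟩ hsv
    · intro e he hi y hy hyv
      have he' := mem_cut_singleton.1 he
      have h1 : φ₁ e = some i := by
        rw [← hi, φout e]
        rintro ⟨h2, h3⟩
        rcases he'.2 with h | h
        · exact hv (h ▸ h2)
        · exact hv (h ▸ h3)
      by_cases hyX : y ∈ X
      · rw [← hβγ]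
        refine hβc e ?_ h1 y hy hyX
        rw [mem_cut]
        rcases hy with rfl | rfl
        · rcases he'.2 with h | h
          · exact absurd h hyv
          · rw [h]
            tauto
        · rcases he'.2 with h | h
          · rw [h]
            tauto
          · exact absurd h hyv
      · rw [← Y₁out y hyX, f₁out y hyX]
        refine hγe e (by rwa [pre₁ v hv]) h1 y ?_ hyv
        rcases hy with h | h
        · exact Or.inl (by rw [Function.comp, ← h, f₁out y hyX])
        · exact Or.inr (by rw [Function.comp, ← h, f₁out y hyX])

/-- Deleting an edge which is in no tight cut. -/
lemma ExtData.exists_of_slack_edge (h : ExtData p q S R v L k ℓ c)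
    (ih : ExtBelow V E (proper p q).card) {e : E} (he : p e ≠ q e)
    (hs : ∀ X, (∃ s ∈ S, s ∈ X) → (∃ s ∈ S, s ∉ X) → e ∈ cut p q X → L < (cut p q X).card) :
    ∃ φ, IsExt p q S R v ℓ c φ := by
  let q' := Function.update q e (p e)
  have q'e : q' e = p e := by simp [q']
  have q'ne : ∀ f, f ≠ e → q' f = q f := fun f hf => by simp [q', hf]
  let c' : V → ℕ := fun w => c w + if w = p e ∨ w = q e then 1 else 0
  have hcut : ∀ X, cut p q' X = (cut p q X).erase e := by
    intro X
    ext f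
    rw [mem_erase, mem_cut, mem_cut]
    by_cases hf : f = e
    · subst hf
      simp [q'e]
    · simp [q'ne f hf, hf]
  have hev : e ∉ cut p q {v} := by
    intro h1
    obtain ⟨s, hs1, hs2⟩ := h.two
    have := hs {v} ⟨v, h.root, rfl⟩ ⟨s, hs1, hs2⟩ h1
    rw [h.deg_root] at this
    exact lt_irrefl _ this
  have hcutv : cut p q' {v} = cut p q {v} := by rw [hcut, erase_eq_of_notMem hev]
  have hcutw : ∀ w, (cut p q' {w}).card + c' w = (cut p q {w}).card + c w := by
    intro w
    rw [hcut]
    by_cases hw : w = p e ∨ w = q e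
    · have hm : e ∈ cut p q {w} := by
        rw [mem_cut_singleton]
        exact ⟨he, hw.imp Eq.symm Eq.symm⟩
      have := card_erase_of_mem hm
      have := card_pos.2 ⟨e, hm⟩
      simp only [c', hw, if_true]
      omega
    · rw [erase_eq_of_notMem]
      · simp only [c', hw, if_false]
        omega
      · intro hm
        rw [mem_cut_singleton] at hm
        exact hw (hm.2.imp Eq.symm Eq.symm)
  obtain ⟨φ, hφ⟩ := ih p q' S R v L k ℓ c' (by
      refine card_lt_card ⟨fun f hf => ?_, fun hsub => ?_⟩
      · rw [mem_proper] at hf ⊢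
        by_cases hfe : f = e
        · rwa [hfe]
        · rwa [q'ne f hfe] at hf
      · exact mem_proper.1 (hsub (mem_proper.2 he)) q'e.symm)
    { pos := h.pos
      big := h.big
      root := h.root
      two := h.two
      conn := by
        intro X h1 h2
        rw [hcut]
        by_cases hm : e ∈ cut p q X
        · rw [card_erase_of_mem hm]
          have := hs X h1 h2 hm
          omega
        · rw [erase_eq_of_notMem hm]
          exact h.conn X h1 h2
      deg_root := by rw [hcutv, h.deg_root]
      label := by
        rw [hcutv]
        exact h.label
      disj := h.disj
      large := by
        intro r hr
        rw [hcutw]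
        exact h.large r hr }
  refine ⟨Function.update φ e none, ?_, ?_, ?_⟩
  · intro f hf
    rw [Function.update_of_ne]
    · exact hφ.root f (hcutv ▸ hf)
    · rintro rfl
      exact hev hf
  · intro w hw hwv
    have h1 := hφ.balance w hw hwv
    rw [hcut] at h1
    unfold Slack at *
    have hsome : ∀ i, ((cut p q {w}).filter fun f => Function.update φ e none f = some i) =
        ((cut p q {w}).erase e).filter fun f => φ f = some i := by
      intro i
      ext f
      by_cases hf : f = e
      · subst hf
        simp
      · simp [hf]
    simp only [hsome]
    refine h1.trans ?_
    by_cases hm : e ∈ cut p q {w}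
    · have : ((cut p q {w}).filter fun f => Function.update φ e none f = none) =
          insert e (((cut p q {w}).erase e).filter fun f => φ f = none) := by
        ext f
        by_cases hf : f = e
        · subst hf
          simp [hm]
        · simp [hf]
      rw [this, card_insert_of_notMem (by simp)]
      simp only [c']
      split_ifs <;> omega
    · have : ((cut p q {w}).filter fun f => Function.update φ e none f = none) =
          (((cut p q {w}).erase e).filter fun f => φ f = none) := by
        ext f
        by_cases hf : f = e
        · subst hf
          simp [hm]
        · simp [hf]
      rw [this]
      have hw' : ¬ (w = p e ∨ w = q e) := fun hw' =>
        hm (mem_cut_singleton.2 ⟨he, hw'.imp Eq.symm Eq.symm⟩)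
      simp only [c', hw', if_false]
      omega
  · intro i Y hY
    have hne : ∀ f, Function.update φ e none f = some i → f ≠ e := by
      rintro f hf rfl
      simp at hf
    obtain ⟨β, h1, h2⟩ := hφ.conn i Y (by
      intro f hf hp hq
      by_cases hfe : f = e
      · rw [hfe, q'e]
      · rw [q'ne f hfe] at hq ⊢
        exact hY f (by rwa [Function.update_of_ne hfe]) hp hq)
    refine ⟨β, h1, fun f hf hi x hx hxv => ?_⟩
    have hfe := hne f hi
    rw [Function.update_of_ne hfe] at hi
    exact h2 f (hcutv ▸ hf) hi x (by rwa [q'ne f hfe]) hxv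

end

end Contraction

section Splitting

open Finset
open scoped Classical

variable {V E : Type}

/-- The set `X` separates `S`. -/
def Sep (S X : Set V) : Prop := (∃ s ∈ S, s ∈ X) ∧ ∃ s ∈ S, s ∉ X

lemma Sep.compl {S X : Set V} (h : Sep S X) : Sep S Xᶜ := by
  obtain ⟨⟨s, hs, hsX⟩, t, ht, htX⟩ := h
  exact ⟨⟨t, ht, htX⟩, s, hs, fun h => h hsX⟩

/-- The edge `e` joins `x` and `y`. -/
def Joins (p q : E → V) (e : E) (x y : V) : Prop :=
  (p e = x ∧ q e = y) ∨ (p e = y ∧ q e = x)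

lemma Joins.symm {p q : E → V} {e : E} {x y : V} (h : Joins p q e x y) : Joins p q e y x :=
  Or.symm h

lemma Joins.eq_of_eq {p q : E → V} {e : E} {x y z : V} (h : Joins p q e x y)
    (h' : Joins p q e x z) : y = z := by
  rcases h with ⟨h1, h2⟩ | ⟨h1, h2⟩ <;> rcases h' with ⟨h3, h4⟩ | ⟨h3, h4⟩
  · rw [← h2, ← h4]
  · rw [← h2, h4, ← h1, h3]
  · rw [← h1, h3, ← h2, h4]
  · rw [← h1, ← h3]

variable [Fintype E]

/-- The edges with one end in `A` and the other end in `B`. -/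
noncomputable def between (p q : E → V) (A B : Set V) : Finset E :=
  univ.filter fun e => (p e ∈ A ∧ q e ∈ B) ∨ (p e ∈ B ∧ q e ∈ A)

lemma Joins.mem_cut {p q : E → V} {e : E} {x y : V} (h : Joins p q e x y) {X : Set V} :
    e ∈ cut p q X ↔ ¬ (x ∈ X ↔ y ∈ X) := by
  rw [SteinerPacking.mem_cut]
  rcases h with ⟨rfl, rfl⟩ | ⟨rfl, rfl⟩
  · rfl
  · rw [iff_comm (a := q e ∈ X)]

lemma exists_joins {p q : E → V} {e : E} {x : V} (h : e ∈ cut p q {x}) :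
    ∃ y, y ≠ x ∧ Joins p q e x y := by
  rw [mem_cut_singleton] at h
  rcases h with ⟨h, rfl | rfl⟩
  · exact ⟨q e, h.symm, Or.inl ⟨rfl, rfl⟩⟩
  · exact ⟨p e, h, Or.inr ⟨rfl, rfl⟩⟩

lemma Joins.mem_between {p q : E → V} {e : E} {x y : V} (h : Joins p q e x y) {A B : Set V}
    (hx : x ∈ A) (hy : y ∈ B) : e ∈ between p q A B := by
  simp only [between, mem_filter, mem_univ, true_and]
  rcases h with ⟨rfl, rfl⟩ | ⟨rfl, rfl⟩
  · exact Or.inl ⟨hx, hy⟩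
  · exact Or.inr ⟨hy, hx⟩

lemma cut_inter_add_cut_union (p q : E → V) (X Y : Set V) :
    (cut p q X).card + (cut p q Y).card = (cut p q (X ∩ Y)).card + (cut p q (X ∪ Y)).card +
      2 * (between p q (X \ Y) (Y \ X)).card := by
  simp only [cut, between, card_filter, mul_sum, ← sum_add_distrib]
  refine sum_congr rfl fun e _ => ?_
  by_cases h1 : p e ∈ X <;> by_cases h2 : q e ∈ X <;> by_cases h3 : p e ∈ Y <;>
    by_cases h4 : q e ∈ Y <;> simp [h1, h2, h3, h4]

lemma cut_sdiff_add_cut_sdiff (p q : E → V) (X Y : Set V) :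
    (cut p q X).card + (cut p q Y).card = (cut p q (X \ Y)).card + (cut p q (Y \ X)).card +
      2 * (between p q (X ∩ Y) (X ∪ Y)ᶜ).card := by
  simp only [cut, between, card_filter, mul_sum, ← sum_add_distrib]
  refine sum_congr rfl fun e _ => ?_
  by_cases h1 : p e ∈ X <;> by_cases h2 : q e ∈ X <;> by_cases h3 : p e ∈ Y <;>
    by_cases h4 : q e ∈ Y <;> simp [h1, h2, h3, h4]

lemma cut_union_of_disjoint (p q : E → V) {X Y : Set V} (h : Disjoint X Y) :
    (cut p q (X ∪ Y)).card + 2 * (cut p q X ∩ cut p q Y).card =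
      (cut p q X).card + (cut p q Y).card := by
  have h' : ∀ x, x ∈ X → x ∈ Y → False := fun x hx hy => Set.disjoint_left.1 h hx hy
  rw [show cut p q X ∩ cut p q Y = univ.filter fun e => e ∈ cut p q X ∧ e ∈ cut p q Y by
    ext; simp]
  simp only [mem_cut]
  simp only [cut, card_filter, mul_sum, ← sum_add_distrib]
  refine sum_congr rfl fun e _ => ?_
  have ha := h' (p e)
  have hb := h' (q e)
  by_cases h1 : p e ∈ X <;> by_cases h2 : q e ∈ X <;> by_cases h3 : p e ∈ Y <;>
    by_cases h4 : q e ∈ Y <;> simp_all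

/-- The structure of a graph in which no tight cut can be contracted on both sides and every edge is in
a tight cut. -/
structure Reduced (p q : E → V) (S : Set V) (L : ℕ) : Prop where
  pos : 0 < L
  two : ∃ s ∈ S, ∃ t ∈ S, s ≠ t
  conn : ∀ X, Sep S X → L ≤ (cut p q X).card
  tight : ∀ X, Sep S X → (cut p q X).card = L → ∃ s ∈ S, cut p q {s} = cut p q X ∧
    ((s ∈ X ∧ ∀ x ∈ X, x ≠ s → cut p q {x} = ∅) ∨ (s ∉ X ∧ ∀ x, x ∉ X → x ≠ s → cut p q {x} = ∅))
  edge : ∀ e, p e ≠ q e → ∃ s ∈ S, (cut p q {s}).card = L ∧ (p e = s ∨ q e = s)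

section
variable {p q : E → V} {S : Set V} {L : ℕ}

lemma tight_singleton (conn : ∀ X, Sep S X → L ≤ (cut p q X).card)
    {X : Set V} (hX : Sep S X) (hc : (cut p q X).card = L)
    (hin : ∀ e, p e ≠ q e → ¬ (p e ∈ X ∧ q e ∈ X)) :
    ∃ s ∈ S, s ∈ X ∧ cut p q {s} = cut p q X ∧ ∀ x ∈ X, x ≠ s → cut p q {x} = ∅ := by
  obtain ⟨⟨s, hs, hsX⟩, t, ht, htX⟩ := hX
  have hsub : ∀ x ∈ X, cut p q {x} ⊆ cut p q X := by
    intro x hx e he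
    obtain ⟨y, hy, hj⟩ := exists_joins he
    rw [hj.mem_cut]
    intro h
    have hyX := h.1 hx
    rcases hj with ⟨h1, h2⟩ | ⟨h1, h2⟩
    · exact hin e (by rw [h1, h2]; exact hy.symm) ⟨h1 ▸ hx, h2 ▸ hyX⟩
    · exact hin e (by rw [h1, h2]; exact hy) ⟨h1 ▸ hyX, h2 ▸ hx⟩
  have hls := conn {s} ⟨⟨s, hs, rfl⟩, t, ht, fun h => htX (Set.mem_singleton_iff.1 h ▸ hsX)⟩
  have heq : cut p q {s} = cut p q X := eq_of_subset_of_card_le (hsub s hsX) (by omega)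
  refine ⟨s, hs, hsX, heq, fun x hx hxs => ?_⟩
  rw [eq_empty_iff_forall_notMem]
  intro e he
  have h1 := hsub x hx he
  rw [← heq] at h1
  obtain ⟨y, hy, hj⟩ := exists_joins he
  have : y = s := by
    rw [mem_cut_singleton] at h1
    rcases hj with ⟨h2, h3⟩ | ⟨h2, h3⟩ <;> rcases h1.2 with h4 | h4
    · exact absurd (h2 ▸ h4) hxs
    · rw [← h3, h4]
    · rw [← h2, h4]
    · exact absurd (h3 ▸ h4) hxs
  have h2 := hsub x hx he
  rw [hj.mem_cut, this] at h2
  exact h2 ⟨fun _ => hsX, fun _ => hx⟩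

lemma Reduced.of_tight (two : ∃ s ∈ S, ∃ t ∈ S, s ≠ t) (pos : 0 < L)
    (conn : ∀ X, Sep S X → L ≤ (cut p q X).card)
    (hA : ∀ X, Sep S X → (cut p q X).card = L → (∀ e, p e ≠ q e → ¬ (p e ∈ X ∧ q e ∈ X)) ∨
      (∀ e, p e ≠ q e → ¬ (p e ∉ X ∧ q e ∉ X)))
    (hB : ∀ e, p e ≠ q e → ∃ X, Sep S X ∧ e ∈ cut p q X ∧ (cut p q X).card = L) :
    Reduced p q S L := by
  have key : ∀ X, Sep S X → (cut p q X).card = L → ∃ s ∈ S, cut p q {s} = cut p q X ∧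
      ((s ∈ X ∧ ∀ x ∈ X, x ≠ s → cut p q {x} = ∅) ∨
        (s ∉ X ∧ ∀ x, x ∉ X → x ≠ s → cut p q {x} = ∅)) := by
    intro X hX hc
    rcases hA X hX hc with h | h
    · obtain ⟨s, h1, h2, h3, h4⟩ := tight_singleton conn hX hc h
      exact ⟨s, h1, h3, Or.inl ⟨h2, h4⟩⟩
    · obtain ⟨s, h1, h2, h3, h4⟩ := tight_singleton conn hX.compl (by rwa [cut_compl]) h
      rw [cut_compl] at h3
      exact ⟨s, h1, h3, Or.inr ⟨h2, h4⟩⟩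
  refine ⟨pos, two, conn, key, fun e he => ?_⟩
  obtain ⟨X, hX, heX, hc⟩ := hB e he
  obtain ⟨s, hs, heq, -⟩ := key X hX hc
  rw [← heq] at heX hc
  exact ⟨s, hs, hc, (mem_cut_singleton.1 heX).2⟩

lemma Reduced.sep_of_mem (h : Reduced p q S L) {X : Set V} {s : V} (hs : s ∈ S) (hsX : s ∈ X)
    (hX : ∀ t ∈ S, t ∈ X → t = s) : Sep S X := by
  obtain ⟨a, ha, b, hb, hab⟩ := h.two
  refine ⟨⟨s, hs, hsX⟩, ?_⟩
  by_contra hno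
  push Not at hno
  exact hab ((hX a ha (hno a ha)).trans (hX b hb (hno b hb)).symm)

lemma Reduced.neighbor (h : Reduced p q S L) {u x : V} {e : E} (hu : u ∉ S) (hux : x ≠ u)
    (he : Joins p q e u x) : x ∈ S ∧ (cut p q {x}).card = L := by
  obtain ⟨s, hs, hc, h1⟩ := h.edge e (by
    rcases he with ⟨h1, h2⟩ | ⟨h1, h2⟩
    · rw [h1, h2]; exact hux.symm
    · rw [h1, h2]; exact hux)
  have : x = s := by
    rcases he with ⟨h2, h3⟩ | ⟨h2, h3⟩ <;> rcases h1 with h1 | h1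
    · exact absurd ((h2.symm.trans h1) ▸ hs) hu
    · rw [← h3, h1]
    · rw [← h2, h1]
    · exact absurd ((h3.symm.trans h1) ▸ hs) hu
  exact this ▸ ⟨hs, hc⟩

/-- At most half of the edges at `u ∉ S` go to the same vertex. -/
lemma Reduced.two_mul_le (h : Reduced p q S L) {u s : V} (hu : u ∉ S) (hs : s ∈ S) :
    2 * (cut p q {s} ∩ cut p q {u}).card ≤ (cut p q {u}).card := by
  by_cases hm : (cut p q {s} ∩ cut p q {u}).card = 0
  · omega
  obtain ⟨e, he⟩ := card_pos.1 (Nat.pos_of_ne_zero hm)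
  rw [mem_inter] at he
  have hus : s ≠ u := fun h => hu (h ▸ hs)
  obtain ⟨y, hy, hj⟩ := exists_joins he.2
  have hys : y = s := by
    have := hj.mem_cut.1 he.1
    simp only [Set.mem_singleton_iff] at this
    by_contra hne
    exact this ⟨fun h => absurd h.symm hus, fun h => absurd h hne⟩
  obtain ⟨-, hc⟩ := h.neighbor hu hy hj
  rw [hys] at hc
  have h1 := cut_union_of_disjoint p q (X := {s}) (Y := {u}) (by simpa using hus)
  have h2 := h.conn ({s} ∪ {u}) (h.sep_of_mem hs (by simp) (by
    rintro t ht (h | h)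
    · exact h
    · rw [Set.mem_singleton_iff] at h
      exact absurd (h ▸ ht) hu))
  omega

/-- A tight set avoiding the non-isolated vertex `u ∉ S` has exactly one non-isolated vertex. -/
lemma Reduced.tight_avoiding (h : Reduced p q S L) {u : V} (hu : u ∉ S)
    (hd : (cut p q {u}).Nonempty) {T : Set V} (hT : Sep S T) (huT : u ∉ T)
    (hc : (cut p q T).card = L) {t : V} (ht : t ∈ S) (htT : t ∈ T) :
    cut p q {t} = cut p q T ∧ ∀ x ∈ T, x ≠ t → cut p q {x} = ∅ := by
  obtain ⟨s, hs, heq, h1 | h1⟩ := h.tight T hT hc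
  · by_cases hts : t = s
    · rw [hts]
      exact ⟨heq, h1.2⟩
    · have h2 := h1.2 t htT hts
      have h3 := h.conn {t} ⟨⟨t, ht, rfl⟩, s, hs, fun h => hts (Set.mem_singleton_iff.1 h).symm⟩
      rw [h2, card_empty] at h3
      have := h.pos
      omega
  · have := h1.2 u huT (fun h => hu (h ▸ hs))
    rw [this] at hd
    simp at hd

/-- The cuts which drop below `L` when two edges from `u` into `X` are split off. -/
def Dangerous (p q : E → V) (S : Set V) (L : ℕ) (u : V) (X : Set V) : Prop :=
  Sep S X ∧ u ∉ X ∧ (cut p q X).card ≤ L + 1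

lemma Reduced.dangerous_le (h : Reduced p q S L) {u : V} (hu : u ∉ S) {X : Set V}
    (hX : Dangerous p q S L u X) :
    2 * (cut p q X ∩ cut p q {u}).card ≤ (cut p q {u}).card + 1 := by
  obtain ⟨⟨⟨s, hs, hsX⟩, t, ht, htX⟩, huX, hc⟩ := hX
  have h1 := cut_union_of_disjoint p q (X := X) (Y := {u}) (by simpa using huX)
  have h2 := h.conn (X ∪ {u}) ⟨⟨s, hs, Or.inl hsX⟩, t, ht, by
    rintro (h | h)
    · exact htX h
    · rw [Set.mem_singleton_iff] at h
      exact hu (h ▸ ht)⟩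
  omega

lemma Reduced.union_dangerous (h : Reduced p q S L) {u : V} (hu : u ∉ S)
    (hd : (cut p q {u}).Nonempty) {X Y : Set V}
    (hX : Dangerous p q S L u X) (hY : Dangerous p q S L u Y)
    (hmax : ∀ Z, Dangerous p q S L u Z → X ⊆ Z → Z ⊆ X) (hYX : ¬ Y ⊆ X)
    {a : V} (ha : a ∈ S) (haX : a ∈ X) (haY : a ∈ Y) {d : V} (hd' : d ∈ S) (hdX : d ∉ X)
    (hdY : d ∉ Y) :
    (cut p q {a} = cut p q (X ∩ Y) ∧ ∀ x ∈ X ∩ Y, x ≠ a → cut p q {x} = ∅) ∧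
      between p q (X \ Y) (Y \ X) = ∅ := by
  have hI : Sep S (X ∩ Y) := ⟨⟨a, ha, haX, haY⟩, d, hd', fun h => hdX h.1⟩
  have hU : Sep S (X ∪ Y) := ⟨⟨a, ha, Or.inl haX⟩, d, hd', by
    rintro (h | h)
    · exact hdX h
    · exact hdY h⟩
  have h1 := cut_inter_add_cut_union p q X Y
  have h2 := h.conn _ hI
  have h3 : L + 2 ≤ (cut p q (X ∪ Y)).card := by
    by_contra hlt
    refine hYX (Set.subset_union_right.trans (hmax (X ∪ Y) ⟨hU, ?_, by omega⟩
      Set.subset_union_left))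
    rintro (h | h)
    · exact hX.2.1 h
    · exact hY.2.1 h
  have h4 := hX.2.2
  have h5 := hY.2.2
  refine ⟨h.tight_avoiding hu hd hI (fun h => hX.2.1 h.1) (by omega) ha ⟨haX, haY⟩, ?_⟩
  rw [← card_eq_zero]
  omega

lemma Reduced.crossing_dangerous (h : Reduced p q S L) {u : V} (hu : u ∉ S)
    {X Y : Set V} (hX : Dangerous p q S L u X) (hY : Dangerous p q S L u Y)
    (hmax : ∀ Z, Dangerous p q S L u Z → X ⊆ Z → Z ⊆ X)
    {a b c : V} (ha : a ∈ S) (hb : b ∈ S) (hc : c ∈ S) (hab : a ≠ b) {ea eb : E}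
    (hea : Joins p q ea u a) (heb : Joins p q eb u b)
    (haX : a ∈ X) (hbX : b ∈ X) (haY : a ∈ Y) (hcY : c ∈ Y) (hcX : c ∉ X) :
    b ∉ Y ∧ (between p q (X ∩ Y) (X ∪ Y)ᶜ).card ≤ 1 ∧
      (cut p q {b} = cut p q (X \ Y) ∧ ∀ x ∈ X \ Y, x ≠ b → cut p q {x} = ∅) ∧
      (cut p q {c} = cut p q (Y \ X) ∧ ∀ x ∈ Y \ X, x ≠ c → cut p q {x} = ∅) := by
  have hau : a ≠ u := fun h => hu (h ▸ ha)
  have hd : (cut p q {u}).Nonempty := ⟨ea, by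
    rw [hea.mem_cut]
    simpa using hau⟩
  have huXY : u ∈ (X ∪ Y)ᶜ := by
    rintro (h | h)
    · exact hX.2.1 h
    · exact hY.2.1 h
  have h1 := cut_sdiff_add_cut_sdiff p q X Y
  have h4 := hX.2.2
  have h5 := hY.2.2
  have hS2 : Sep S (Y \ X) := ⟨⟨c, hc, hcY, hcX⟩, a, ha, fun h => h.2 haX⟩
  have h3 := h.conn _ hS2
  have hbY : b ∉ Y := by
    intro hbY
    by_cases hs : ∃ s ∈ S, s ∈ X ∧ s ∉ Y
    · obtain ⟨s, hs, hsX, hsY⟩ := hs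
      have h2 := h.conn (X \ Y) ⟨⟨s, hs, hsX, hsY⟩, a, ha, fun h => h.2 haY⟩
      have h6 : 1 < (between p q (X ∩ Y) (X ∪ Y)ᶜ).card := by
        rw [one_lt_card]
        refine ⟨ea, hea.symm.mem_between ⟨haX, haY⟩ huXY, eb, heb.symm.mem_between ⟨hbX, hbY⟩ huXY, ?_⟩
        rintro rfl
        exact hab (hea.eq_of_eq heb)
      omega
    · push Not at hs
      obtain ⟨-, d, hd', hdY⟩ := hY.1
      have h6 := (h.union_dangerous hu hd hX hY hmax (fun h => hcX (h hcY)) ha haX haY hd'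
        (fun h => hdY (hs d hd' h)) hdY).1.2 b ⟨hbX, hbY⟩ hab.symm
      have : eb ∈ cut p q {b} := by
        rw [heb.mem_cut]
        have : u ≠ b := fun h => hu (h ▸ hb)
        simpa using this
      rw [h6] at this
      simp at this
  have hS1 : Sep S (X \ Y) := ⟨⟨b, hb, hbX, hbY⟩, a, ha, fun h => h.2 haY⟩
  have h2 := h.conn _ hS1
  have h6 : 0 < (between p q (X ∩ Y) (X ∪ Y)ᶜ).card :=
    card_pos.2 ⟨ea, hea.symm.mem_between ⟨haX, haY⟩ huXY⟩
  refine ⟨hbY, by omega, h.tight_avoiding hu hd hS1 (fun h => hX.2.1 h.1) (by omega) hb ⟨hbX, hbY⟩,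
    h.tight_avoiding hu hd hS2 (fun h => hY.2.1 h.1) (by omega) hc ⟨hcY, hcX⟩⟩

/-- Some two edges at a vertex `u ∉ S` of degree at least four can be split off. -/
theorem Reduced.exists_splittable [Finite V] (h : Reduced p q S L) (hL : 2 ≤ L) {u : V} (hu : u ∉ S)
    (hdeg : 4 ≤ (cut p q {u}).card) :
    ∃ a b e f, Joins p q e u a ∧ Joins p q f u b ∧ a ≠ u ∧ b ≠ u ∧ a ≠ b ∧
      ∀ X, Dangerous p q S L u X → a ∈ X → b ∉ X := by
  by_contra hcon
  push Not at hcon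
  let N : Set V := {x | x ≠ u ∧ ∃ e, Joins p q e u x}
  have hNS : ∀ x ∈ N, x ∈ S := by
    rintro x ⟨hx, e, he⟩
    exact (h.neighbor hu hx he).1
  have hd : (cut p q {u}).Nonempty := by
    rw [← card_pos]
    omega
  have hpair : ∀ a ∈ N, ∀ b ∈ N, a ≠ b →
      ∃ X, Dangerous p q S L u X ∧ a ∈ X ∧ b ∈ X := by
    rintro a ⟨ha, e, he⟩ b ⟨hb, f, hf⟩ hab
    exact hcon a b e f he hf ha hb hab
  have hmaxpair : ∀ a ∈ N, ∀ b ∈ N, a ≠ b → ∃ X, Dangerous p q S L u X ∧ a ∈ X ∧ b ∈ X ∧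
      ∀ Z, Dangerous p q S L u Z → X ⊆ Z → Z ⊆ X := by
    intro a ha b hb hab
    obtain ⟨X₀, h0⟩ := hpair a ha b hb hab
    obtain ⟨X, hX⟩ := Set.Finite.exists_maximal
      (s := {X : Set V | Dangerous p q S L u X ∧ a ∈ X ∧ b ∈ X}) (Set.toFinite _) ⟨X₀, h0⟩
    refine ⟨X, hX.prop.1, hX.prop.2.1, hX.prop.2.2, fun Z hZ hXZ => ?_⟩
    exact hX.le_of_ge ⟨hZ, hXZ hX.prop.2.1, hXZ hX.prop.2.2⟩ hXZ
  have hmem : ∀ x ∈ N, ∀ e, Joins p q e u x → ∀ X, u ∉ X → (e ∈ cut p q X ↔ x ∈ X) := by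
    intro x hx e he X hX
    rw [he.mem_cut]
    tauto
  have houtside : ∀ X, Dangerous p q S L u X → ∃ c ∈ N, c ∉ X := by
    intro X hX
    have h1 := h.dangerous_le hu hX
    have h2 : (cut p q X ∩ cut p q {u}).card < (cut p q {u}).card := by omega
    obtain ⟨e, he, he'⟩ := exists_mem_notMem_of_card_lt_card h2
    obtain ⟨c, hcu, hj⟩ := exists_joins he
    refine ⟨c, ⟨hcu, e, hj⟩, fun hc => he' (mem_inter.2 ⟨?_, he⟩)⟩
    rw [hmem c ⟨hcu, e, hj⟩ e hj X hX.2.1]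
    exact hc
  have hother : ∀ a ∈ N, ∃ b ∈ N, a ≠ b := by
    intro a ha
    have h1 := h.two_mul_le hu (hNS a ha)
    have h2 : (cut p q {a} ∩ cut p q {u}).card < (cut p q {u}).card := by omega
    obtain ⟨e, he, he'⟩ := exists_mem_notMem_of_card_lt_card h2
    obtain ⟨b, hbu, hj⟩ := exists_joins he
    refine ⟨b, ⟨hbu, e, hj⟩, ?_⟩
    rintro rfl
    refine he' (mem_inter.2 ⟨?_, he⟩)
    rw [hj.mem_cut]
    simpa using hbu.symm
  have hcross : ∀ a ∈ N, ∀ b ∈ N, ∀ c ∈ N, a ≠ b → ∀ X Y, Dangerous p q S L u X →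
      Dangerous p q S L u Y → (∀ Z, Dangerous p q S L u Z → X ⊆ Z → Z ⊆ X) →
      a ∈ X → b ∈ X → a ∈ Y → c ∈ Y → c ∉ X →
      b ∉ Y ∧ (between p q (X ∩ Y) (X ∪ Y)ᶜ).card ≤ 1 ∧
      (cut p q {b} = cut p q (X \ Y) ∧ ∀ x ∈ X \ Y, x ≠ b → cut p q {x} = ∅) ∧
      (cut p q {c} = cut p q (Y \ X) ∧ ∀ x ∈ Y \ X, x ≠ c → cut p q {x} = ∅) := by
    rintro a ha b hb c hc hab X Y hX hY hmax haX hbX haY hcY hcX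
    obtain ⟨-, ea, hea⟩ := id ha
    obtain ⟨-, eb, heb⟩ := id hb
    exact h.crossing_dangerous hu hX hY hmax (hNS a ha) (hNS b hb) (hNS c hc) hab hea heb
      haX hbX haY hcY hcX
  have hnot : ∀ X Y, Dangerous p q S L u X → Dangerous p q S L u Y → u ∈ (X ∪ Y)ᶜ := by
    rintro X Y hX hY (h | h)
    · exact hX.2.1 h
    · exact hY.2.1 h
  have hsimple : ∀ a ∈ N, ∀ e f, Joins p q e u a → Joins p q f u a → e = f := by
    intro a ha e f he hf
    obtain ⟨b, hb, hab⟩ := hother a ha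
    obtain ⟨X, hX, haX, hbX, hmax⟩ := hmaxpair a ha b hb hab
    obtain ⟨c, hc, hcX⟩ := houtside X hX
    obtain ⟨Y, hY, haY, hcY⟩ := hpair a ha c hc (fun h => hcX (h ▸ haX))
    have h1 := (hcross a ha b hb c hc hab X Y hX hY hmax haX hbX haY hcY hcX).2.1
    have hu' := hnot X Y hX hY
    exact card_le_one.1 h1 e (he.symm.mem_between ⟨haX, haY⟩ hu') f
      (hf.symm.mem_between ⟨haX, haY⟩ hu')
  have hnonempty : ∀ x ∈ N, cut p q {x} ≠ ∅ := by
    rintro x ⟨hx, e, he⟩ h0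
    have : e ∈ cut p q {x} := by
      rw [he.mem_cut]
      simpa using hx.symm
    rw [h0] at this
    simp at this
  have hsub : ∀ a ∈ N, ∀ b ∈ N, ∀ c ∈ N, a ≠ b → ∀ X Y, Dangerous p q S L u X →
      Dangerous p q S L u Y → (∀ Z, Dangerous p q S L u Z → X ⊆ Z → Z ⊆ X) →
      a ∈ X → b ∈ X → a ∈ Y → c ∈ Y → c ∉ X → ∀ x ∈ N, x ∈ X ∪ Y → x = a ∨ x = b ∨ x = c := by
    intro a ha b hb c hc hab X Y hX hY hmax haX hbX haY hcY hcX x hx hxXY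
    obtain ⟨-, h1, h2, h3⟩ := hcross a ha b hb c hc hab X Y hX hY hmax haX hbX haY hcY hcX
    have hu' := hnot X Y hX hY
    obtain ⟨-, ea, hea⟩ := id ha
    obtain ⟨-, ex, hex⟩ := id hx
    by_cases hxX : x ∈ X
    · by_cases hxY : x ∈ Y
      · have := card_le_one.1 h1 ea (hea.symm.mem_between ⟨haX, haY⟩ hu') ex
          (hex.symm.mem_between ⟨hxX, hxY⟩ hu')
        subst this
        exact Or.inl (hex.eq_of_eq hea)
      · by_contra hne
        push Not at hne
        exact hnonempty x hx (h2.2 x ⟨hxX, hxY⟩ hne.2.1)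
    · have hxY : x ∈ Y := hxXY.resolve_left hxX
      by_contra hne
      push Not at hne
      exact hnonempty x hx (h3.2 x ⟨hxY, hxX⟩ hne.2.2)
  have hfour : ∀ a b c, ∃ d ∈ N, d ≠ a ∧ d ≠ b ∧ d ≠ c := by
    intro a b c
    let o : E → V := fun e => if p e = u then q e else p e
    have ho : ∀ e x, Joins p q e u x → o e = x := by
      rintro e x (⟨h1, h2⟩ | ⟨h1, h2⟩)
      · simp [o, h1, h2]
      · by_cases h3 : p e = u
        · simp only [o, h3, if_true, h2]
          rw [← h1, h3]
        · rw [← h1]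
          exact if_neg h3
    have hinj : Set.InjOn o (cut p q {u}) := by
      intro e he f hf hef
      obtain ⟨x, hxu, hx⟩ := exists_joins (mem_coe.1 he)
      obtain ⟨y, hyu, hy⟩ := exists_joins (mem_coe.1 hf)
      rw [ho e x hx, ho f y hy] at hef
      subst hef
      exact hsimple x ⟨hxu, e, hx⟩ e f hx hy
    have hcard : ({a, b, c} : Finset V).card < ((cut p q {u}).image o).card := by
      rw [card_image_of_injOn hinj]
      have : ({a, b, c} : Finset V).card ≤ 3 := card_le_three
      omega
    obtain ⟨d, hd, hd'⟩ := exists_mem_notMem_of_card_lt_card hcard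
    obtain ⟨e, he, rfl⟩ := mem_image.1 hd
    obtain ⟨x, hxu, hx⟩ := exists_joins he
    refine ⟨x, ⟨hxu, e, hx⟩, ?_⟩
    rw [ho e x hx] at hd'
    simpa using hd'
  have hall : ∀ a ∈ N, ∀ b ∈ N, ∀ c ∈ N, a ≠ b → a ≠ c → b ≠ c → ∃ X Y,
      Dangerous p q S L u X ∧ cut p q {a} = cut p q (X ∩ Y) ∧ cut p q {b} = cut p q (X \ Y) ∧
      ∀ e, ¬ Joins p q e b c := by
    intro a ha b hb c hc hab hac hbc
    obtain ⟨X, hX, haX, hbX, hmax⟩ := hmaxpair a ha b hb hab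
    have hcX : c ∉ X := by
      intro hcX
      obtain ⟨d, hd, hdX⟩ := houtside X hX
      obtain ⟨Y, hY, haY, hdY⟩ := hpair a ha d hd (fun h => hdX (h ▸ haX))
      rcases hsub a ha b hb d hd hab X Y hX hY hmax haX hbX haY hdY hdX c hc (Or.inl hcX) with
        h | h | h
      · exact hac h.symm
      · exact hbc h.symm
      · exact hdX (h ▸ hcX)
    obtain ⟨Y, hY, haY, hcY⟩ := hpair a ha c hc hac
    obtain ⟨d, hdN, hda, hdb, hdc⟩ := hfour a b c
    have hdXY : d ∉ X ∪ Y := by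
      intro hd
      rcases hsub a ha b hb c hc hab X Y hX hY hmax haX hbX haY hcY hcX d hdN hd with h | h | h
      · exact hda h
      · exact hdb h
      · exact hdc h
    obtain ⟨h1, -, h2, -⟩ := hcross a ha b hb c hc hab X Y hX hY hmax haX hbX haY hcY hcX
    obtain ⟨h3, h4⟩ := h.union_dangerous hu hd hX hY hmax (fun h => hcX (h hcY)) (hNS a ha) haX haY
      (hNS d hdN) (fun h => hdXY (Or.inl h)) (fun h => hdXY (Or.inr h))
    refine ⟨X, Y, hX, h3.1, h2.1, fun e he => ?_⟩
    have := he.mem_between (A := X \ Y) (B := Y \ X) ⟨hbX, h1⟩ ⟨hcY, hcX⟩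
    rw [h4] at this
    simp at this
  obtain ⟨a, ha, -⟩ := hfour u u u
  obtain ⟨b, hb, hba, -⟩ := hfour a a a
  obtain ⟨c, hc, hca, hcb, -⟩ := hfour a b b
  obtain ⟨-, -, -, -, -, hno⟩ := hall c hc a ha b hb hca hcb hba.symm
  obtain ⟨X, Y, hX, h1, h2, -⟩ := hall a ha b hb c hc hba.symm hca.symm hcb.symm
  have h3 := cut_union_of_disjoint p q (X := X ∩ Y) (Y := X \ Y)
    (Set.disjoint_left.2 fun x hx hx' => hx'.2 hx.2)
  have h4 : cut p q (X ∩ Y) ∩ cut p q (X \ Y) = ∅ := by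
    rw [← h1, ← h2, eq_empty_iff_forall_notMem]
    intro e he
    rw [mem_inter] at he
    obtain ⟨y, hy, hj⟩ := exists_joins he.1
    have := hj.mem_cut.1 he.2
    simp only [Set.mem_singleton_iff] at this
    have hyb : y = b := by
      by_contra hne
      exact this ⟨fun h => absurd h.symm hba, fun h => absurd h hne⟩
    exact hno e (hyb ▸ hj)
  rw [Set.inter_union_sdiff, h4, ← h1, ← h2, card_empty] at h3
  obtain ⟨ha', ea, hea⟩ := ha
  obtain ⟨hb', eb, heb⟩ := hb
  have h5 := (h.neighbor hu ha' hea).2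
  have h6 := (h.neighbor hu hb' heb).2
  have h7 := hX.2.2
  omega

end

end Splitting

section Reduction

open Finset
open scoped Classical

lemma Slack.of_equiv {E : Type} {k : ℕ} {φ φ' : E → Option (Fin k)} {D D' : Finset E} {n : ℕ}
    (σ : E ≃ E) (hD : ∀ g, g ∈ D ↔ σ g ∈ D') (hφ : ∀ g ∈ D, φ g = φ' (σ g)) (h : Slack φ' D' n) :
    Slack φ D n := by
  have key : ∀ o, (D.filter fun g => φ g = o).card = (D'.filter fun g => φ' g = o).card := by
    intro o
    refine card_equiv σ fun g => ?_
    rw [mem_filter, mem_filter, ← hD]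
    refine and_congr_right fun hg => ?_
    rw [hφ g hg]
  unfold Slack at *
  simpa only [key] using h

variable {V E : Type} [Fintype E]
variable {p q : E → V} {S R : Set V} {v : V} {L k : ℕ} {ℓ : E → Fin k} {c : V → ℕ}

/-- Splitting off the edges `ua` and `ub`, which get the label of the new edge `ab`. -/
lemma ExtData.exists_of_split (h : ExtData p q S R v L k ℓ c)
    (ih : ExtBelow V E (proper p q).card) {u a b : V} {e f : E} (hu : u ∉ S)
    (hc : u ∈ R → 2 * k ≤ c u) (he : Joins p q e u a) (hf : Joins p q f u b) (hau : a ≠ u)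
    (hbu : b ≠ u) (hab : a ≠ b) (hbv : b ≠ v)
    (hd : ∀ X, Dangerous p q S L u X → a ∈ X → b ∉ X) : ∃ φ, IsExt p q S R v ℓ c φ := by
  have hef : e ≠ f := by
    rintro rfl
    exact hab (he.eq_of_eq hf)
  have huv : u ≠ v := fun h' => hu (h' ▸ h.root)
  let p' : E → V := fun g => if g = f then u else if g = e then a else p g
  let q' : E → V := fun g => if g = f then u else if g = e then b else q g
  have p'e : p' e = a := by simp [p', hef]
  have q'e : q' e = b := by simp [q', hef]
  have p'f : p' f = u := by simp [p']
  have q'f : q' f = u := by simp [q']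
  have p'ne : ∀ g, g ≠ e → g ≠ f → p' g = p g := fun g h1 h2 => by simp [p', h1, h2]
  have q'ne : ∀ g, g ≠ e → g ≠ f → q' g = q g := fun g h1 h2 => by simp [q', h1, h2]
  have e' : ∀ X, e ∈ cut p' q' X ↔ ¬ (a ∈ X ↔ b ∈ X) := fun X => by rw [mem_cut, p'e, q'e]
  have f' : ∀ X, f ∉ cut p' q' X := fun X => by simp [mem_cut, p'f, q'f]
  have hne : ∀ X g, g ≠ e → g ≠ f → (g ∈ cut p' q' X ↔ g ∈ cut p q X) := by
    intro X g h1 h2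
    rw [mem_cut, mem_cut, p'ne g h1 h2, q'ne g h1 h2]
  have hsplit : ∀ A : Finset E, A.card =
      ((A.erase e).erase f).card + (if e ∈ A then 1 else 0) + if f ∈ A then 1 else 0 := by
    intro A
    have h1 : (A.erase e).card + (if e ∈ A then 1 else 0) = A.card := by
      by_cases hm : e ∈ A
      · simpa [hm] using card_erase_add_one hm
      · simp [hm]
    have h2 : ((A.erase e).erase f).card + (if f ∈ A then 1 else 0) = (A.erase e).card := by
      by_cases hm : f ∈ A
      · have hm' : f ∈ A.erase e := mem_erase.2 ⟨hef.symm, hm⟩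
        simpa [hm] using card_erase_add_one hm'
      · simp [hm]
    omega
  have hrest : ∀ X, ((cut p' q' X).erase e).erase f = ((cut p q X).erase e).erase f := by
    intro X
    ext g
    simp only [mem_erase]
    constructor
    · rintro ⟨h1, h2, h3⟩
      exact ⟨h1, h2, (hne X g h2 h1).1 h3⟩
    · rintro ⟨h1, h2, h3⟩
      exact ⟨h1, h2, (hne X g h2 h1).2 h3⟩
  have hconn : ∀ X, Sep S X → L ≤ (cut p' q' X).card := by
    intro X hX
    have h1 := hsplit (cut p q X)
    have h2 := hsplit (cut p' q' X)
    have h3 := h.conn X hX.1 hX.2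
    rw [hrest] at h2
    simp only [e', f', he.mem_cut, hf.mem_cut] at h1 h2
    have h4 : a ∈ X → b ∈ X → u ∉ X → L + 1 < (cut p q X).card := by
      intro ha hb hu'
      by_contra hlt
      exact hd X ⟨hX, hu', by omega⟩ ha hb
    have h5 : a ∉ X → b ∉ X → u ∈ X → L + 1 < (cut p q X).card := by
      intro ha hb hu'
      by_contra hlt
      exact hd Xᶜ ⟨hX.compl, fun h => h hu', by rw [cut_compl]; omega⟩ ha hb
    by_cases ha : a ∈ X <;> by_cases hb : b ∈ X <;> by_cases hu' : u ∈ X <;>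
      simp [ha, hb, hu'] at h1 h2 h4 h5 <;> omega
  have hcutw : ∀ w, w ≠ u → w ≠ b → cut p' q' {w} = cut p q {w} := by
    intro w hwu hwb
    ext g
    by_cases hge : g = e
    · rw [hge, e', he.mem_cut]
      simp only [Set.mem_singleton_iff]
      tauto
    · by_cases hgf : g = f
      · have h1 := f' {w}
        rw [hgf, hf.mem_cut]
        simp only [Set.mem_singleton_iff]
        tauto
      · exact hne _ g hge hgf
  have heb : e ∉ cut p q {b} := by
    rw [he.mem_cut]
    simp only [Set.mem_singleton_iff]
    tauto
  have hfb : f ∈ cut p q {b} := by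
    rw [hf.mem_cut]
    simp only [Set.mem_singleton_iff]
    tauto
  have heb' : e ∈ cut p' q' {b} := by
    rw [e']
    simp only [Set.mem_singleton_iff]
    tauto
  have hswap : ∀ g, g ∈ cut p q {b} ↔ Equiv.swap e f g ∈ cut p' q' {b} := by
    intro g
    by_cases hge : g = e
    · rw [hge, Equiv.swap_apply_left]
      exact ⟨fun h => absurd h heb, fun h => absurd h (f' _)⟩
    · by_cases hgf : g = f
      · rw [hgf, Equiv.swap_apply_right]
        exact ⟨fun _ => heb', fun _ => hfb⟩
      · rw [Equiv.swap_apply_of_ne_of_ne hge hgf, hne _ g hge hgf]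
  have hcard : ∀ w, w ≠ u → (cut p' q' {w}).card = (cut p q {w}).card := by
    intro w hwu
    by_cases hwb : w = b
    · rw [hwb]
      exact (card_equiv _ hswap).symm
    · rw [hcutw w hwu hwb]
  have hcutv := hcutw v huv.symm hbv.symm
  obtain ⟨φ, hφ⟩ := ih p' q' S (R \ {u}) v L k ℓ c (by
      refine card_lt_card ⟨fun g hg => ?_, fun hsub => ?_⟩
      · rw [mem_proper] at hg ⊢
        by_cases hge : g = e
        · rw [hge]
          rcases he with ⟨h1, h2⟩ | ⟨h1, h2⟩
          · rw [h1, h2]; exact hau.symm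
          · rw [h1, h2]; exact hau
        · by_cases hgf : g = f
          · rw [hgf] at hg
            exact absurd (p'f.trans q'f.symm) hg
          · rwa [p'ne g hge hgf, q'ne g hge hgf] at hg
      · refine mem_proper.1 (hsub (mem_proper.2 ?_)) (p'f.trans q'f.symm)
        rcases hf with ⟨h1, h2⟩ | ⟨h1, h2⟩
        · rw [h1, h2]; exact hbu.symm
        · rw [h1, h2]; exact hbu)
    { pos := h.pos
      big := h.big
      root := h.root
      two := h.two
      conn := fun X h1 h2 => hconn X ⟨h1, h2⟩
      deg_root := by rw [hcutv, h.deg_root]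
      label := by
        rw [hcutv]
        exact h.label
      disj := fun r hr => h.disj r hr.1
      large := by
        rintro r ⟨hr, hru⟩
        rw [hcard r hru]
        exact h.large r hr }
  let ψ : E → Option (Fin k) := fun g => if g = f then φ e else φ g
  have ψf : ψ f = φ e := if_pos rfl
  have ψne : ∀ g, g ≠ f → ψ g = φ g := fun g hg => if_neg hg
  have hfv : f ∉ cut p q {v} := by
    rw [hf.mem_cut]
    simp only [Set.mem_singleton_iff]
    tauto
  have hstep : ∀ {g x y}, Joins p q g x y → ∀ i (Y : Set V),
      (∀ e, ψ e = some i → p e ≠ v → q e ≠ v → (p e ∈ Y ↔ q e ∈ Y)) →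
      ψ g = some i → x ≠ v → y ≠ v → (x ∈ Y ↔ y ∈ Y) := by
    rintro g x y (⟨rfl, rfl⟩ | ⟨rfl, rfl⟩) i Y hY hg hx hy
    · exact hY g hg hx hy
    · exact (hY g hg hy hx).symm
  refine ⟨ψ, ?_, ?_, ?_⟩
  · intro g hg
    rw [ψne g (fun h => hfv (h ▸ hg))]
    exact hφ.root g (hcutv ▸ hg)
  · intro w hw hwv
    by_cases hwu : w = u
    · subst hwu
      have h1 : ∑ i, (2 - ((cut p q {w}).filter fun e => ψ e = some i).card) ≤ ∑ _i : Fin k, 2 :=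
        sum_le_sum fun i _ => Nat.sub_le _ _
      have h2 := hc (hw.resolve_left hu)
      simp only [sum_const, card_univ, Fintype.card_fin, smul_eq_mul] at h1
      unfold Slack
      omega
    · have h1 := hφ.balance w (hw.imp id fun h => ⟨h, hwu⟩) hwv
      by_cases hwb : w = b
      · rw [hwb] at h1 ⊢
        refine h1.of_equiv (Equiv.swap e f) hswap fun g hg => ?_
        have hge : g ≠ e := fun h => heb (h ▸ hg)
        by_cases hgf : g = f
        · rw [hgf, Equiv.swap_apply_right, ψf]
        · rw [Equiv.swap_apply_of_ne_of_ne hge hgf, ψne g hgf]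
      · rw [hcutw w hwu hwb] at h1
        refine h1.of_erase fun g hg => Or.inr (ψne g ?_)
        rintro rfl
        rw [hf.mem_cut] at hg
        simp only [Set.mem_singleton_iff] at hg
        tauto
  · intro i Y hY
    obtain ⟨β, h1, h2⟩ := hφ.conn i Y (by
      intro g hg hp hq
      by_cases hge : g = e
      · rw [hge] at hg hp hq ⊢
        rw [p'e, q'e] at *
        rw [← hstep he i Y hY (by rw [ψne e hef, hg]) huv hp]
        exact hstep hf i Y hY (by rw [ψf, hg]) huv hq
      · by_cases hgf : g = f
        · rw [hgf, p'f, q'f]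
        · rw [p'ne g hge hgf, q'ne g hge hgf] at *
          exact hY g (by rw [ψne g hgf, hg]) hp hq)
    refine ⟨β, h1, fun g hg hi x hx hxv => ?_⟩
    have hgf : g ≠ f := fun h => hfv (h ▸ hg)
    rw [ψne g hgf] at hi
    by_cases hge : g = e
    · subst hge
      have hav : a = v := by
        rw [he.mem_cut] at hg
        simp only [Set.mem_singleton_iff] at hg
        by_contra hne
        exact hg ⟨fun h => absurd h huv, fun h => absurd h hne⟩
      have hxu : x = u := by
        rcases he with ⟨h3, h4⟩ | ⟨h3, h4⟩ <;> rcases hx with h5 | h5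
        · rw [h5, h3]
        · exact absurd (h5.trans (h4.trans hav)) hxv
        · exact absurd (h5.trans (h3.trans hav)) hxv
        · rw [h5, h4]
      rw [hxu, hstep hf i Y hY (by rw [ψf, hi]) huv hbv]
      exact h2 g (hcutv ▸ hg) hi b (Or.inr q'e.symm) hbv
    · exact h2 g (hcutv ▸ hg) hi x (by rwa [p'ne g hge hgf, q'ne g hge hgf]) hxv

/-- Either there is an extension, or the graph is reduced and its small vertices outside of `S` have
exactly three neighbours. -/
theorem ExtData.exists_or_reduced [Finite V] (h : ExtData p q S R v L k ℓ c)
    (ih : ExtBelow V E (proper p q).card) : (∃ φ, IsExt p q S R v ℓ c φ) ∨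
      (Reduced p q S L ∧ ∀ u ∉ S, (u ∈ R → 2 * k ≤ c u) → cut p q {u} = ∅ ∨
        ((cut p q {u}).card = 3 ∧
          ∀ x e f, x ≠ u → Joins p q e u x → Joins p q f u x → e = f)) := by
  by_cases hex : ∃ φ, IsExt p q S R v ℓ c φ
  · exact Or.inl hex
  refine Or.inr ?_
  have hpos := h.pos
  have hbig := h.big
  have hred : Reduced p q S L := by
    obtain ⟨s, hs, hsv⟩ := h.two
    refine Reduced.of_tight ⟨s, hs, v, h.root, hsv⟩ (by omega) (fun X hX => h.conn X hX.1 hX.2) ?_ ?_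
    · intro X hX hc
      by_contra hno
      push Not at hno
      obtain ⟨⟨e, he, h1, h2⟩, f, hf, h3, h4⟩ := hno
      by_cases hv : v ∈ X
      · refine hex (h.exists_of_tight ih (X := Xᶜ) (fun h => h hv) hX.compl.1 (by rwa [cut_compl])
          ⟨f, hf, h3, h4⟩ ⟨e, he, fun h => h h1, fun h => h h2⟩)
      · exact hex (h.exists_of_tight ih hv hX.1 hc ⟨e, he, h1, h2⟩ ⟨f, hf, h3, h4⟩)
    · intro e he
      by_contra hno
      push Not at hno
      refine hex (h.exists_of_slack_edge ih he fun X h1 h2 h3 => ?_)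
      have := h.conn X h1 h2
      have := hno X ⟨h1, h2⟩ h3
      omega
  refine ⟨hred, fun u hu hc => ?_⟩
  have hsplit : ∀ a b e f, Joins p q e u a → Joins p q f u b → a ≠ u → b ≠ u → a ≠ b →
      ¬ ∀ X, Dangerous p q S L u X → a ∈ X → b ∉ X := by
    intro a b e f he hf hau hbu hab hd
    by_cases hbv : b = v
    · exact hex (h.exists_of_split ih hu hc hf he hbu hau hab.symm (fun h => hab (h.trans hbv.symm))
        fun X hX hb ha => hd X hX ha hb)
    · exact hex (h.exists_of_split ih hu hc he hf hau hbu hab hbv hd)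
  have hmult : ∀ x e f, x ≠ u → Joins p q e u x → Joins p q f u x → e ≠ f →
      4 ≤ (cut p q {u}).card := by
    intro x e f hxu he hf hef
    have h1 := hred.two_mul_le hu (hred.neighbor hu hxu he).1
    have h2 : 1 < (cut p q {x} ∩ cut p q {u}).card := by
      rw [one_lt_card]
      refine ⟨e, ?_, f, ?_, hef⟩
      · rw [mem_inter, he.mem_cut, he.mem_cut]
        simp [hxu, hxu.symm]
      · rw [mem_inter, hf.mem_cut, hf.mem_cut]
        simp [hxu, hxu.symm]
    omega
  by_cases h4 : 4 ≤ (cut p q {u}).card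
  · obtain ⟨a, b, e, f, he, hf, hau, hbu, hab, hd⟩ := hred.exists_splittable (by omega) hu h4
    exact absurd hd (hsplit a b e f he hf hau hbu hab)
  have hsimple : ∀ x e f, x ≠ u → Joins p q e u x → Joins p q f u x → e = f := by
    intro x e f hxu he hf
    by_contra hef
    exact h4 (hmult x e f hxu he hf hef)
  have hcases : (cut p q {u}).card = 0 ∨ (cut p q {u}).card = 1 ∨ (cut p q {u}).card = 2 ∨
      (cut p q {u}).card = 3 := by omega
  rcases hcases with h0 | h1 | h2 | h3
  · exact Or.inl (card_eq_zero.1 h0)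
  · exfalso
    obtain ⟨e, he⟩ := card_pos.1 (by omega : 0 < (cut p q {u}).card)
    obtain ⟨x, hxu, hj⟩ := exists_joins he
    have h2 := hred.two_mul_le hu (hred.neighbor hu hxu hj).1
    have h3 : 0 < (cut p q {x} ∩ cut p q {u}).card := by
      refine card_pos.2 ⟨e, mem_inter.2 ⟨?_, he⟩⟩
      rw [hj.mem_cut]
      simp [hxu.symm]
    omega
  · exfalso
    obtain ⟨e, he, f, hf, hef⟩ := one_lt_card.1 (by omega : 1 < (cut p q {u}).card)
    obtain ⟨a, hau, hja⟩ := exists_joins he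
    obtain ⟨b, hbu, hjb⟩ := exists_joins hf
    have hab : a ≠ b := by
      rintro rfl
      exact hef (hsimple a e f hau hja hjb)
    refine hsplit a b e f hja hjb hau hbu hab fun X hX ha hb => ?_
    have h3 := hred.dangerous_le hu hX
    have h5 := hX.2.1
    have h6 : 1 < (cut p q X ∩ cut p q {u}).card := by
      rw [one_lt_card]
      refine ⟨e, mem_inter.2 ⟨?_, he⟩, f, mem_inter.2 ⟨?_, hf⟩, hef⟩
      · rw [hja.mem_cut]
        tauto
      · rw [hjb.mem_cut]
        tauto
    omega
  · exact Or.inr ⟨h3, hsimple⟩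

end Reduction

section Endgame

open Finset
open scoped Classical

variable {V E : Type} [Fintype E]

/-- A graph in which every vertex outside `S ∪ A` is isolated or has three distinct neighbours, and in
which the vertices of `A` outside `S` have large degree. -/
structure Terminal (p q : E → V) (S A : Set V) (v : V) (L k : ℕ) : Prop where
  red : Reduced p q S L
  big : 36 * k ≤ L
  root : v ∈ S
  deg_root : (cut p q {v}).card = L
  mem_of_mem : ∀ s ∈ S, s ≠ v → s ∈ A
  root_notMem : v ∉ A
  large : ∀ r ∈ A, r ∉ S → L ≤ (cut p q {r}).card + 4 * k
  small : ∀ u, u ∉ S → u ∉ A → cut p q {u} = ∅ ∨ ((cut p q {u}).card = 3 ∧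
    ∀ x e f, x ≠ u → Joins p q e u x → Joins p q f u x → e = f)

/-- The vertices of `A` spanned by an edge inside `A`, or adjacent to a vertex outside `S ∪ A`. -/
def span (p q : E → V) (S A : Set V) : E ⊕ V → Set V
  | Sum.inl e => {x | p e ≠ q e ∧ p e ∈ A ∧ q e ∈ A ∧ (x = p e ∨ x = q e)}
  | Sum.inr u => {x | u ∉ S ∧ u ∉ A ∧ x ∈ A ∧ ∃ e, Joins p q e u x}

/-- The edge `e` joins `v` to the vertex outside `S ∪ A` represented by `h`. -/
def Anchor (p q : E → V) (S A : Set V) (v : V) (h : E ⊕ V) (e : E) : Prop :=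
  ∃ u, h = Sum.inr u ∧ u ∉ S ∧ u ∉ A ∧ Joins p q e u v

/-- The set `X` with all vertices outside `S ∪ A` sending two edges to `X`. -/
def hull (p q : E → V) (S A X : Set V) : Set V :=
  X ∪ {u | u ∉ S ∧ u ∉ A ∧ ∃ e f a b, e ≠ f ∧ a ∈ X ∧ b ∈ X ∧ Joins p q e u a ∧ Joins p q f u b}

lemma Joins.mem_cut_left {p q : E → V} {e : E} {x y : V} (h : Joins p q e x y) (hxy : y ≠ x) :
    e ∈ cut p q {x} := by
  rw [h.mem_cut]
  simp [hxy]

lemma Joins.mem_cut_right {p q : E → V} {e : E} {x y : V} (h : Joins p q e x y) (hxy : y ≠ x) :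
    e ∈ cut p q {y} :=
  h.symm.mem_cut_left hxy.symm

lemma joins_or_of_mem_cut {p q : E → V} {e : E} {X : Set V} (h : e ∈ cut p q X) :
    ∃ x y, x ∈ X ∧ y ∉ X ∧ Joins p q e x y := by
  rw [mem_cut] at h
  by_cases h1 : p e ∈ X
  · exact ⟨p e, q e, h1, fun h2 => h ⟨fun _ => h2, fun _ => h1⟩, Or.inl ⟨rfl, rfl⟩⟩
  · refine ⟨q e, p e, ?_, h1, Or.inr ⟨rfl, rfl⟩⟩
    tauto

namespace Terminal

variable {p q : E → V} {S A X : Set V} {v : V} {L k : ℕ}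

lemma eq_or_mem (T : Terminal p q S A v L k) {u x : V} {e : E} (hu : u ∉ S) (hux : x ≠ u)
    (he : Joins p q e u x) : x = v ∨ (x ∈ A ∧ x ∈ S) := by
  have := (T.red.neighbor hu hux he).1
  by_cases h : x = v
  · exact Or.inl h
  · exact Or.inr ⟨T.mem_of_mem x this h, this⟩

lemma card_le_three (T : Terminal p q S A v L k) {u : V} (hu : u ∉ S) (hA : u ∉ A) :
    (cut p q {u}).card ≤ 3 := by
  rcases T.small u hu hA with h | h
  · simp [h]
  · exact h.1.le

lemma simple (T : Terminal p q S A v L k) {u x : V} {e f : E} (hu : u ∉ S) (hA : u ∉ A)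
    (hx : x ≠ u) (he : Joins p q e u x) (hf : Joins p q f u x) : e = f := by
  rcases T.small u hu hA with h | h
  · have := he.mem_cut_left hx
    simp [h] at this
  · exact h.2 x e f hx he hf

lemma exists_span_bound (T : Terminal p q S A v L k) (h : E ⊕ V) :
    ∃ F : Finset V, F.card ≤ 3 ∧ ((∃ e, Anchor p q S A v h e) → F.card ≤ 2) ∧
      ∀ x ∈ span p q S A h, x ∈ F := by
  rcases h with e | u
  · refine ⟨{p e, q e}, card_le_two.trans (by norm_num), fun _ => card_le_two, ?_⟩
    rintro x ⟨-, -, -, rfl | rfl⟩ <;> simp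
  · by_cases hu : u ∉ S ∧ u ∉ A
    · let o : E → V := fun e => if p e = u then q e else p e
      have ho : ∀ e x, Joins p q e u x → o e = x := by
        rintro e x (⟨h1, h2⟩ | ⟨h1, h2⟩)
        · simp [o, h1, h2]
        · by_cases h : p e = u
          · simp only [o, h, if_true]
            rw [h2, ← h1, h]
          · simp only [o, h, if_false]
            exact h1
      refine ⟨((cut p q {u}).image o).erase v, ?_, ?_, ?_⟩
      · exact (card_erase_le.trans card_image_le).trans (T.card_le_three hu.1 hu.2)
      · rintro ⟨e, u', he, -, -, hj⟩
        obtain rfl := Sum.inr.inj he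
        have hv : v ∈ (cut p q {u}).image o :=
          mem_image.2 ⟨e, hj.mem_cut_left fun h => hu.1 (h ▸ T.root), ho e v hj⟩
        rw [card_erase_of_mem hv]
        have := (card_image_le (s := cut p q {u}) (f := o)).trans (T.card_le_three hu.1 hu.2)
        omega
      · rintro x ⟨-, -, hx, e, he⟩
        refine mem_erase.2 ⟨fun h => T.root_notMem (h ▸ hx), mem_image.2 ⟨e, ?_, ho e x he⟩⟩
        exact he.mem_cut_left fun h => hu.2 (h ▸ hx)
    · refine ⟨∅, by simp, by simp, ?_⟩
      rintro x ⟨h1, h2, -⟩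
      exact absurd ⟨h1, h2⟩ hu

lemma root_notMem_hull (T : Terminal p q S A v L k) (hX : X ⊆ A) : v ∉ hull p q S A X := by
  rintro (h | h)
  · exact T.root_notMem (hX h)
  · exact h.1 T.root

lemma card_cut_hull_le [Fintype V] (T : Terminal p q S A v L k) (hX : X ⊆ A) :
    (cut p q (hull p q S A X)).card ≤ (cut p q (hull p q S A X) ∩ cut p q {v}).card +
      (univ.filter fun h => (∃ x ∈ span p q S A h, x ∈ X) ∧ ∃ x ∈ span p q S A h, x ∉ X).card := by
  rw [← card_sdiff_add_card_inter (cut p q (hull p q S A X)) (cut p q {v}), add_comm]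
  refine Nat.add_le_add_left ?_ _
  have key : ∀ e ∈ cut p q (hull p q S A X) \ cut p q {v},
      (p e ∈ A ∧ q e ∈ A ∧ (p e ∈ X ∧ q e ∉ X ∨ p e ∉ X ∧ q e ∈ X)) ∨
      ∃ u x, u ∉ S ∧ u ∉ A ∧ x ∈ A ∧ Joins p q e u x ∧ (u ∈ hull p q S A X ↔ x ∉ X) := by
    intro e he
    rw [mem_sdiff] at he
    obtain ⟨x, y, hx, hy, hj⟩ := joins_or_of_mem_cut he.1
    have hxy : y ≠ x := fun h => hy (h ▸ hx)
    have hxv : x ≠ v := fun h => T.root_notMem_hull hX (h ▸ hx)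
    have hyv : y ≠ v := fun h => he.2 (h ▸ hj.mem_cut_right hxy)
    by_cases hyA : y ∈ A
    · rcases hx with hx' | hx'
      · left
        have h1 : y ∉ X := fun h => hy (Or.inl h)
        have h2 := hX hx'
        rcases hj with ⟨h3, h4⟩ | ⟨h3, h4⟩ <;> rw [h3, h4] <;> tauto
      · right
        exact ⟨x, y, hx'.1, hx'.2.1, hyA, hj, by
          have h1 : y ∉ X := fun h => hy (Or.inl h)
          exact ⟨fun _ => h1, fun _ => Or.inr hx'⟩⟩
    · right
      have hyS : y ∉ S := fun h => hyA (T.mem_of_mem y h hyv)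
      have hxA : x ∈ A := by
        rcases T.eq_or_mem hyS hxy.symm hj.symm with h | h
        · exact absurd h hxv
        · exact h.1
      refine ⟨y, x, hyS, hyA, hxA, hj.symm, ?_⟩
      have : x ∈ X := by
        rcases hx with h | h
        · exact h
        · exact absurd hxA h.2.1
      simp [hy, this]
  have huniq : ∀ u e f x y, u ∉ S → u ∉ A → x ∈ A → y ∈ A → Joins p q e u x → Joins p q f u y →
      (u ∈ hull p q S A X ↔ x ∉ X) → (u ∈ hull p q S A X ↔ y ∉ X) → e = f := by
    intro u e f x y hu hA hx hy he hf h1 h2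
    by_contra hef
    by_cases huX : u ∈ hull p q S A X
    · have hxX := h1.1 huX
      have hyX := h2.1 huX
      rcases huX with h | ⟨-, -, e', f', a, b, hef', ha, hb, hja, hjb⟩
      · exact hA (hX h)
      have hne : ∀ z, z ∈ A → z ≠ u := fun z hz h => hA (h ▸ hz)
      have hsub : ({e, f, e', f'} : Finset E) ⊆ cut p q {u} := by
        intro g hg
        simp only [mem_insert, mem_singleton] at hg
        rcases hg with rfl | rfl | rfl | rfl
        · exact he.mem_cut_left (hne _ hx)
        · exact hf.mem_cut_left (hne _ hy)
        · exact hja.mem_cut_left (hne _ (hX ha))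
        · exact hjb.mem_cut_left (hne _ (hX hb))
      have hd : ∀ {g g' : E} {z z' : V}, Joins p q g u z → Joins p q g' u z' → z ∉ X → z' ∈ X →
          g ≠ g' := by
        rintro g _ z z' h3 h4 h5 h6 rfl
        exact h5 (h3.eq_of_eq h4 ▸ h6)
      have hcard : ({e, f, e', f'} : Finset E).card = 4 := by
        rw [card_insert_of_notMem, card_insert_of_notMem, card_insert_of_notMem, card_singleton]
        · simpa using hef'
        · simpa using ⟨hd hf hja hyX ha, hd hf hjb hyX hb⟩
        · simpa using ⟨hef, hd he hja hxX ha, hd he hjb hxX hb⟩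
      have := card_le_card hsub
      have := T.card_le_three hu hA
      omega
    · refine huX (Or.inr ⟨hu, hA, e, f, x, y, hef, ?_, ?_, he, hf⟩) <;> tauto
  let P : E → V → Prop := fun e u => ∃ x, u ∉ S ∧ u ∉ A ∧ x ∈ A ∧ Joins p q e u x ∧
    (u ∈ hull p q S A X ↔ x ∉ X)
  let f : E → E ⊕ V := fun e => if h : ∃ u, P e u then Sum.inr h.choose else Sum.inl e
  have hf : ∀ e, (∃ u, P e u ∧ f e = Sum.inr u) ∨ ((¬ ∃ u, P e u) ∧ f e = Sum.inl e) := by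
    intro e
    by_cases h : ∃ u, P e u
    · exact Or.inl ⟨h.choose, h.choose_spec, by simp only [f, dif_pos h]⟩
    · exact Or.inr ⟨h, by simp only [f, dif_neg h]⟩
  refine card_le_card_of_injOn f ?_ ?_
  · intro e he
    rw [mem_coe] at he
    rw [mem_coe, mem_filter]
    refine ⟨mem_univ _, ?_⟩
    have he' := mem_sdiff.1 he
    rcases hf e with ⟨u, ⟨x, hu, hA, hx, hj, hiff⟩, hfe⟩ | ⟨hno, hfe⟩
    · rw [hfe]
      have hxs : x ∈ span p q S A (Sum.inr u) := ⟨hu, hA, hx, e, hj⟩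
      by_cases huX : u ∈ hull p q S A X
      · refine ⟨?_, x, hxs, hiff.1 huX⟩
        rcases huX with h | ⟨-, -, e', f', a, b, hef', ha, hb, hja, hjb⟩
        · exact absurd (hX h) hA
        · exact ⟨a, ⟨hu, hA, hX ha, e', hja⟩, ha⟩
      · have hxX : x ∈ X := by tauto
        refine ⟨⟨x, hxs, hxX⟩, ?_⟩
        have h3 : (cut p q {u}).card = 3 := by
          rcases T.small u hu hA with h | h
          · have := hj.mem_cut_left (x := u) fun h' => hA (h' ▸ hx)
            simp [h] at this
          · exact h.1
        have : ∃ g ∈ cut p q {u}, g ≠ e ∧ ¬ Joins p q g u v := by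
          by_contra hno
          push Not at hno
          obtain ⟨g, hg, g', hg', hgg⟩ := one_lt_card.1 (by
            rw [card_erase_of_mem (hj.mem_cut_left fun h' => hA (h' ▸ hx)), h3]
            norm_num : 1 < ((cut p q {u}).erase e).card)
          rw [mem_erase] at hg hg'
          exact hgg (T.simple hu hA (fun h => hu (h ▸ T.root)) (hno g hg.2 hg.1)
            (hno g' hg'.2 hg'.1))
        obtain ⟨g, hg, hge, hgv⟩ := this
        obtain ⟨y, hyu, hjy⟩ := exists_joins hg
        rcases T.eq_or_mem hu hyu hjy with h | h
        · exact absurd (h ▸ hjy) hgv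
        · refine ⟨y, ⟨hu, hA, h.1, g, hjy⟩, fun hyX => huX (Or.inr ?_)⟩
          exact ⟨hu, hA, g, e, y, x, hge, hyX, hxX, hjy, hj⟩
    · rw [hfe]
      rcases key e he with ⟨h1, h2, h3⟩ | ⟨u, x, h⟩
      · have hne : p e ≠ q e := by
          intro h
          rw [h] at h3
          tauto
        have hp : p e ∈ span p q S A (Sum.inl e) := ⟨hne, h1, h2, Or.inl rfl⟩
        have hq : q e ∈ span p q S A (Sum.inl e) := ⟨hne, h1, h2, Or.inr rfl⟩
        rcases h3 with h3 | h3
        · exact ⟨⟨_, hp, h3.1⟩, _, hq, h3.2⟩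
        · exact ⟨⟨_, hq, h3.2⟩, _, hp, h3.1⟩
      · exact absurd ⟨u, x, h⟩ hno
  · intro e _ e' _ hee
    rcases hf e with ⟨u, ⟨x, hu, hA, hx, hj, hiff⟩, hfe⟩ | ⟨-, hfe⟩ <;>
      rcases hf e' with ⟨u', ⟨x', hu', hA', hx', hj', hiff'⟩, hfe'⟩ | ⟨-, hfe'⟩ <;>
      rw [hfe, hfe'] at hee
    · obtain rfl := Sum.inr.inj hee
      exact huniq u e e' x x' hu hA hx hx' hj hj' hiff hiff'
    · simp at hee
    · simp at hee
    · exact Sum.inl.inj hee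

/-- The hypergraph edges leaving `X`. -/
noncomputable def leaving [Fintype V] (p q : E → V) (S A X : Set V) : Finset (E ⊕ V) :=
  univ.filter fun h => (∃ x ∈ span p q S A h, x ∈ X) ∧ ∃ x ∈ span p q S A h, x ∉ X

lemma large_of_subset [Fintype V] (T : Terminal p q S A v L k) (hX : X ⊆ A) (hne : X.Nonempty) :
    L ≤ (cut p q (hull p q S A X) ∩ cut p q {v}).card + (leaving p q S A X).card + 4 * k ∧
    (L ≤ (cut p q (hull p q S A X) ∩ cut p q {v}).card + (leaving p q S A X).card ∨
      16 * k ≤ ((leaving p q S A X).filter fun h => ¬ ∃ e, Anchor p q S A v h e).card) := by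
  have hle := T.card_cut_hull_le hX
  change _ ≤ _ + (leaving p q S A X).card at hle
  by_cases hs : ∃ s ∈ S, s ∈ X
  · obtain ⟨s, hs, hsX⟩ := hs
    have := T.red.conn (hull p q S A X) ⟨⟨s, hs, Or.inl hsX⟩, v, T.root, T.root_notMem_hull hX⟩
    omega
  · obtain ⟨r, hr⟩ := hne
    have hrS : r ∉ S := fun h => hs ⟨r, h, hr⟩
    have hlr := T.large r (hX hr) hrS
    have hsub : cut p q {r} ⊆ cut p q (hull p q S A X) := by
      intro e he
      obtain ⟨y, hy, hj⟩ := exists_joins he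
      have hyS := (T.red.neighbor hrS hy hj).1
      rw [hj.mem_cut]
      intro h
      rcases h.1 (Or.inl hr) with h | h
      · exact hs ⟨y, hyS, h⟩
      · exact h.1 hyS
    have h1 := card_le_card hsub
    refine ⟨by omega, Or.inr ?_⟩
    have h2 := T.red.two_mul_le hrS T.root
    have h3 := card_sdiff_add_card_inter (cut p q {r}) (cut p q {v})
    rw [inter_comm] at h3
    have h4 := T.big
    have h5 : (cut p q {r} \ cut p q {v}).card ≤
        ((leaving p q S A X).filter fun h => ¬ ∃ e, Anchor p q S A v h e).card := by
      refine card_le_card_of_injOn Sum.inl ?_ (fun _ _ _ _ h => Sum.inl.inj h)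
      intro e he
      rw [mem_coe, mem_sdiff] at he
      obtain ⟨y, hy, hj⟩ := exists_joins he.1
      have hyS := (T.red.neighbor hrS hy hj).1
      have hyv : y ≠ v := fun h => he.2 (h ▸ hj.mem_cut_right hy)
      have hyA := T.mem_of_mem y hyS hyv
      have hspan : ∀ x, x = r ∨ x = y → x ∈ span p q S A (Sum.inl e) := by
        have := hX hr
        rcases hj with ⟨rfl, rfl⟩ | ⟨rfl, rfl⟩
        · exact fun x hx => ⟨hy.symm, this, hyA, hx⟩
        · exact fun x hx => ⟨hy, hyA, this, hx.symm⟩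
      simp only [leaving, mem_coe, mem_filter, mem_univ, true_and]
      refine ⟨⟨⟨r, hspan r (Or.inl rfl), hr⟩, y, hspan y (Or.inr rfl), fun h => hs ⟨y, hyS, h⟩⟩, ?_⟩
      rintro ⟨f, u, hu, -⟩
      simp at hu
    omega

/-- The class of a quotient of `A`, as a set of vertices. -/
def cell (t : Setoid A) (j : Quotient t) : Set V := {x | ∃ h : x ∈ A, Quotient.mk t ⟨x, h⟩ = j}

lemma cell_subset (t : Setoid A) (j : Quotient t) : cell t j ⊆ A := fun _ h => h.1

lemma cell_nonempty (t : Setoid A) (j : Quotient t) : (cell t j).Nonempty := by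
  obtain ⟨x, rfl⟩ := Quotient.exists_rep j
  exact ⟨x, x.2, rfl⟩

lemma cell_unique {t : Setoid A} {i j : Quotient t} {x : V} (hi : x ∈ cell t i)
    (hj : x ∈ cell t j) : i = j := by
  obtain ⟨h, rfl⟩ := hi
  obtain ⟨h', rfl⟩ := hj
  rfl

/-- The hypergraph edges meeting at least two classes of `t`. -/
noncomputable def crossing [Fintype V] (p q : E → V) (S A : Set V) (t : Setoid A) :
    Finset (E ⊕ V) :=
  univ.filter fun h => ∃ a b : A, (a : V) ∈ span p q S A h ∧ (b : V) ∈ span p q S A h ∧ ¬ t a b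

omit [Fintype E] in
lemma span_subset (h : E ⊕ V) : span p q S A h ⊆ A := by
  rcases h with e | u
  · rintro x ⟨-, h1, h2, rfl | rfl⟩
    · exact h1
    · exact h2
  · exact fun x hx => hx.2.2.1

lemma leaving_cell_subset [Fintype V] (t : Setoid A) (j : Quotient t) :
    leaving p q S A (cell t j) ⊆ crossing p q S A t := by
  intro h hh
  simp only [leaving, crossing, mem_filter, mem_univ, true_and] at hh ⊢
  obtain ⟨⟨x, hx, hxA, hxj⟩, y, hy, hyj⟩ := hh
  refine ⟨⟨x, hxA⟩, ⟨y, span_subset h hy⟩, hx, hy, fun hr => hyj ⟨span_subset h hy, ?_⟩⟩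
  rw [← hxj]
  exact (Quotient.sound hr).symm

lemma card_meeting_le (t : Setoid A) [Fintype (Quotient t)] (F : Finset V) :
    (univ.filter fun j : Quotient t => ∃ x ∈ F, x ∈ cell t j).card ≤ F.card := by
  rcases isEmpty_or_nonempty V with _ | _
  · rw [filter_false_of_mem fun j _ ⟨x, _⟩ => isEmptyElim x]
    simp
  have : ∀ j ∈ (univ.filter fun j : Quotient t => ∃ x ∈ F, x ∈ cell t j),
      ∃ x, x ∈ F ∧ x ∈ cell t j := by
    intro j hj
    simpa using hj
  choose! g hg using this
  exact card_le_card_of_injOn g (fun j hj => (hg j hj).1)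
    fun i hi j hj hij => cell_unique (hg i hi).2 (hij ▸ (hg j hj).2)

lemma sum_card_filter_le {H J : Type} [Fintype J] (C : Finset H) (r : J → H → Prop)
    [∀ j h, Decidable (r j h)] (b : ℕ)
    (hb : ∀ h ∈ C, (univ.filter fun j => r j h).card ≤ b) :
    ∑ j, (C.filter fun h => r j h).card ≤ b * C.card := by
  have := sum_card_bipartiteAbove_eq_sum_card_bipartiteBelow (s := univ) (t := C) r
  simp only [bipartiteAbove, bipartiteBelow] at this
  rw [this, mul_comm]
  exact sum_le_card_nsmul C _ b hb

lemma hull_cell_unique (T : Terminal p q S A v L k) {t : Setoid A} {i j : Quotient t} {x : V}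
    (hi : x ∈ hull p q S A (cell t i)) (hj : x ∈ hull p q S A (cell t j)) : i = j := by
  rcases hi with hi | ⟨hu, hA, e, f, a, b, hef, ha, hb, hea, hfb⟩
  · rcases hj with hj | hj
    · exact cell_unique hi hj
    · exact absurd (cell_subset t i hi) hj.2.1
  · rcases hj with hj | ⟨-, -, e', f', a', b', hef', ha', hb', hea', hfb'⟩
    · exact absurd (cell_subset t j hj) hA
    · by_contra hij
      have hne : ∀ z l, z ∈ cell t l → z ≠ x := fun z l hz h => hA (h ▸ cell_subset t l hz)
      have hsub : ({e, f, e', f'} : Finset E) ⊆ cut p q {x} := by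
        intro g hg
        simp only [mem_insert, mem_singleton] at hg
        rcases hg with rfl | rfl | rfl | rfl
        · exact hea.mem_cut_left (hne _ _ ha)
        · exact hfb.mem_cut_left (hne _ _ hb)
        · exact hea'.mem_cut_left (hne _ _ ha')
        · exact hfb'.mem_cut_left (hne _ _ hb')
      have hd : ∀ {g g' : E} {z z' : V}, Joins p q g x z → Joins p q g' x z' → z ∈ cell t i →
          z' ∈ cell t j → g ≠ g' := by
        rintro g _ z z' h3 h4 h5 h6 rfl
        exact hij (cell_unique h5 (h3.eq_of_eq h4 ▸ h6))
      have hcard : ({e, f, e', f'} : Finset E).card = 4 := by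
        rw [card_insert_of_notMem, card_insert_of_notMem, card_insert_of_notMem, card_singleton]
        · simpa using hef'
        · simpa using ⟨hd hfb hea' hb ha', hd hfb hfb' hb hb'⟩
        · simpa using ⟨hef, hd hea hea' ha ha', hd hea hfb' ha hb'⟩
      have := card_le_card hsub
      have := T.card_le_three hu hA
      omega

/-- The crossing hypergraph edges coming from neighbors of `v`. -/
noncomputable def anchored [Fintype V] (p q : E → V) (S A : Set V) (v : V) (t : Setoid A) :
    Finset (E ⊕ V) :=
  (crossing p q S A t).filter fun h => ∃ e, Anchor p q S A v h e

/-- The other crossing hypergraph edges. -/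
noncomputable def floating [Fintype V] (p q : E → V) (S A : Set V) (v : V) (t : Setoid A) :
    Finset (E ⊕ V) :=
  (crossing p q S A t).filter fun h => ¬ ∃ e, Anchor p q S A v h e

lemma mem_cut_of_anchor (T : Terminal p q S A v L k) {h : E ⊕ V} {e : E}
    (he : Anchor p q S A v h e) : e ∈ cut p q {v} := by
  obtain ⟨u, -, hu, -, hj⟩ := he
  exact hj.mem_cut_right fun h => hu (h ▸ T.root)

omit [Fintype E] in
lemma anchor_unique {h h' : E ⊕ V} {e : E}
    (he : Anchor p q S A v h e) (he' : Anchor p q S A v h' e) : h = h' := by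
  obtain ⟨u, rfl, -, -, hj⟩ := he
  obtain ⟨u', rfl, -, -, hj'⟩ := he'
  rw [hj.symm.eq_of_eq hj'.symm]

lemma anchor_edge_unique (T : Terminal p q S A v L k) {h : E ⊕ V} {e f : E}
    (he : Anchor p q S A v h e) (hf : Anchor p q S A v h f) : e = f := by
  obtain ⟨u, rfl, hu, hA, hj⟩ := he
  obtain ⟨u', hu', -, -, hk⟩ := hf
  obtain rfl := Sum.inr.inj hu'
  exact T.simple hu hA (fun h => hu (h ▸ T.root)) hj hk

/-- Edges at `v` to distinct hulls of cells, and to crossing hypergraph edges, are distinct. -/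
lemma sum_card_root_le [Fintype V] (T : Terminal p q S A v L k) (t : Setoid A)
    [Fintype (Quotient t)] :
    ∑ j, (cut p q (hull p q S A (cell t j)) ∩ cut p q {v}).card + (anchored p q S A v t).card ≤
      L := by
  have hanch : ∀ h ∈ anchored p q S A v t, ∃ e, Anchor p q S A v h e :=
    fun h hh => (mem_filter.1 hh).2
  have : Nonempty E := by
    obtain ⟨e, -⟩ := card_pos.1 (T.deg_root ▸ T.red.pos)
    exact ⟨e⟩
  choose! f hf using hanch
  have hother : ∀ j e, e ∈ cut p q (hull p q S A (cell t j)) ∩ cut p q {v} →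
      ∃ y ∈ hull p q S A (cell t j), Joins p q e v y := by
    intro j e he
    rw [mem_inter] at he
    obtain ⟨y, hy, hj⟩ := exists_joins he.2
    refine ⟨y, ?_, hj⟩
    have h1 := hj.mem_cut.1 he.1
    by_contra hy'
    exact h1 ⟨fun h => absurd h (T.root_notMem_hull (cell_subset t j)), fun h => absurd h hy'⟩
  have hinj : (anchored p q S A v t).card = ((anchored p q S A v t).image f).card := by
    rw [card_image_of_injOn]
    intro h hh h' hh' heq
    exact anchor_unique (hf h hh) (heq ▸ hf h' hh')
  rw [hinj, ← card_biUnion, ← card_union_of_disjoint, ← T.deg_root]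
  · refine card_le_card (union_subset (biUnion_subset.2 fun j _ => inter_subset_right) ?_)
    intro e he
    obtain ⟨h, hh, rfl⟩ := mem_image.1 he
    exact T.mem_cut_of_anchor (hf h hh)
  · rw [disjoint_left]
    intro e he he'
    obtain ⟨j, -, hj⟩ := mem_biUnion.1 he
    obtain ⟨h, hh, rfl⟩ := mem_image.1 he'
    obtain ⟨y, hy, hjy⟩ := hother j _ hj
    obtain ⟨u, rfl, hu, hA, hju⟩ := hf h hh
    obtain rfl := hjy.eq_of_eq hju.symm
    rcases hy with hy | ⟨-, -, e, e', a, b, hee, ha, hb, hja, hjb⟩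
    · exact hA (cell_subset t j hy)
    · have hcr := (mem_filter.1 (mem_filter.1 hh).1).2
      have hall : ∀ x ∈ span p q S A (Sum.inr y), x ∈ cell t j := by
        by_contra hno
        push Not at hno
        obtain ⟨x, ⟨-, -, hx, g, hg⟩, hxj⟩ := hno
        have hne : ∀ z, z ∈ A → z ≠ y := fun z hz h => hA (h ▸ hz)
        have hvA := T.root_notMem
        have hyv : v ≠ y := fun h => hu (h ▸ T.root)
        set g' := f (Sum.inr y)
        have hsub : ({e, e', g, g'} : Finset E) ⊆ cut p q {y} := by
          intro i hi
          simp only [mem_insert, mem_singleton] at hi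
          rcases hi with rfl | rfl | rfl | rfl
          · exact hja.mem_cut_left (hne _ (cell_subset t j ha))
          · exact hjb.mem_cut_left (hne _ (cell_subset t j hb))
          · exact hg.mem_cut_left (hne _ hx)
          · exact hju.mem_cut_left hyv
        have hd : ∀ {g g' : E} {z z' : V}, Joins p q g y z → Joins p q g' y z' → z ≠ z' →
            g ≠ g' := by
          rintro g _ z z' h3 h4 h5 rfl
          exact h5 (h3.eq_of_eq h4)
        have hcv : ∀ {z}, z ∈ cell t j → z ≠ v := fun hz h => hvA (h ▸ cell_subset t j hz)
        have hcx : ∀ {z}, z ∈ cell t j → z ≠ x := fun hz h => hxj (h ▸ hz)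
        have hcard : ({e, e', g, g'} : Finset E).card = 4 := by
          rw [card_insert_of_notMem, card_insert_of_notMem, card_insert_of_notMem, card_singleton]
          · simpa using hd hg hju fun h => hvA (h ▸ hx)
          · simpa using ⟨hd hjb hg (hcx hb), hd hjb hju (hcv hb)⟩
          · simpa using ⟨hee, hd hja hg (hcx ha), hd hja hju (hcv ha)⟩
        have := card_le_card hsub
        have := T.card_le_three hu hA
        omega
      obtain ⟨a', b', ha', hb', hab⟩ := hcr
      obtain ⟨h1, h2⟩ := hall _ ha'
      obtain ⟨h3, h4⟩ := hall _ hb'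
      exact hab (Quotient.exact (h2.trans h4.symm))
  · intro i _ j _ hij
    rw [Function.onFun, disjoint_left]
    intro e hi hj
    obtain ⟨y, hy, hjy⟩ := hother i _ hi
    obtain ⟨y', hy', hjy'⟩ := hother j _ hj
    exact hij (T.hull_cell_unique hy (hjy.eq_of_eq hjy' ▸ hy'))

lemma card_quotient_mul_le [Fintype V] (T : Terminal p q S A v L k) (t : Setoid A)
    [Fintype (Quotient t)] :
    (anchored p q S A v t).card ≤ L ∧
    Fintype.card (Quotient t) * L ≤ L + (anchored p q S A v t).card +
      3 * (floating p q S A v t).card + 4 * k * Fintype.card (Quotient t) ∧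
    (16 * k ≤ (floating p q S A v t).card ∨
      Fintype.card (Quotient t) * L ≤ L + (anchored p q S A v t).card +
        Fintype.card (Quotient t) * (floating p q S A v t).card) := by
  have hroot := T.sum_card_root_le t
  have hsplit : ∀ j, (leaving p q S A (cell t j)).card =
      ((anchored p q S A v t).filter fun h => h ∈ leaving p q S A (cell t j)).card +
      ((floating p q S A v t).filter fun h => h ∈ leaving p q S A (cell t j)).card := by
    intro j
    have hsub := leaving_cell_subset (p := p) (q := q) (S := S) t j
    rw [anchored, floating, filter_filter, filter_filter,
      ← card_filter_add_card_filter_not (s := leaving p q S A (cell t j))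
        fun h => ∃ e, Anchor p q S A v h e]
    congr 2 <;> ext h <;> rw [mem_filter, mem_filter]
    · exact ⟨fun hh => ⟨hsub hh.1, hh.2, hh.1⟩, fun hh => ⟨hh.2.2, hh.2.1⟩⟩
    · exact ⟨fun hh => ⟨hsub hh.1, hh.2, hh.1⟩, fun hh => ⟨hh.2.2, hh.2.1⟩⟩
  have hanch : ∑ j, ((anchored p q S A v t).filter fun h => h ∈ leaving p q S A (cell t j)).card ≤
      2 * (anchored p q S A v t).card := by
    refine sum_card_filter_le _ (fun j h => h ∈ leaving p q S A (cell t j)) 2 fun h hh => ?_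
    obtain ⟨F, -, hF, hsub⟩ := T.exists_span_bound h
    refine le_trans (card_le_card ?_) ((card_meeting_le t F).trans (hF (mem_filter.1 hh).2))
    intro j hj
    simp only [leaving, mem_filter, mem_univ, true_and] at hj ⊢
    obtain ⟨x, hx, hxj⟩ := hj.1
    exact ⟨x, hsub x hx, hxj⟩
  have hfloat : ∑ j, ((floating p q S A v t).filter fun h => h ∈ leaving p q S A (cell t j)).card ≤
      3 * (floating p q S A v t).card := by
    refine sum_card_filter_le _ (fun j h => h ∈ leaving p q S A (cell t j)) 3 fun h hh => ?_
    obtain ⟨F, hF, -, hsub⟩ := T.exists_span_bound h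
    refine le_trans (card_le_card ?_) ((card_meeting_le t F).trans hF)
    intro j hj
    simp only [leaving, mem_filter, mem_univ, true_and] at hj ⊢
    obtain ⟨x, hx, hxj⟩ := hj.1
    exact ⟨x, hsub x hx, hxj⟩
  have hfloat' : ∀ j, ((floating p q S A v t).filter fun h => h ∈ leaving p q S A (cell t j)).card ≤
      (floating p q S A v t).card := fun j => card_filter_le _ _
  have hlarge := fun j => T.large_of_subset (cell_subset t j) (cell_nonempty t j)
  refine ⟨by omega, ?_, ?_⟩
  · have h1 := sum_le_sum fun j (_ : j ∈ univ) => (hlarge j).1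
    simp only [hsplit, sum_add_distrib, sum_const, card_univ, smul_eq_mul] at h1
    rw [mul_comm (4 * k)]
    omega
  · by_cases h16 : 16 * k ≤ (floating p q S A v t).card
    · exact Or.inl h16
    · right
      have h1 := sum_le_sum fun j (_ : j ∈ univ) => show L ≤ _ from (hlarge j).2.resolve_right (by
        intro h
        refine h16 (h.trans (card_le_card ?_))
        intro h hh
        rw [mem_filter] at hh
        exact mem_filter.2 ⟨leaving_cell_subset t j hh.1, hh.2⟩)
      have h2 := sum_le_sum fun j (_ : j ∈ univ) => hfloat' j
      simp only [hsplit, sum_add_distrib, sum_const, card_univ, smul_eq_mul] at h1 h2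
      omega

lemma card_anchored_add_le [Fintype V] (T : Terminal p q S A v L k) (t : Setoid A)
    (ℓ : E → Fin k) (hℓ : ∀ i, 2 ≤ ((cut p q {v}).filter fun e => ℓ e = i).card) (J : Finset (Fin k))
    (hJ : ∀ i ∈ J, ∀ h ∈ anchored p q S A v t, ∀ e, Anchor p q S A v h e → ℓ e ≠ i) :
    2 * J.card + (anchored p q S A v t).card ≤ L := by
  have hanch : ∀ h ∈ anchored p q S A v t, ∃ e, Anchor p q S A v h e :=
    fun h hh => (mem_filter.1 hh).2
  have : Nonempty E := by
    obtain ⟨e, -⟩ := card_pos.1 (T.deg_root ▸ T.red.pos)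
    exact ⟨e⟩
  choose! f hf using hanch
  have hinj : (anchored p q S A v t).card = ((anchored p q S A v t).image f).card := by
    rw [card_image_of_injOn]
    intro h hh h' hh' heq
    exact anchor_unique (hf h hh) (heq ▸ hf h' hh')
  have hlab : 2 * J.card ≤ ((cut p q {v}).filter fun e => ℓ e ∈ J).card := by
    rw [card_eq_sum_card_fiberwise (s := (cut p q {v}).filter fun e => ℓ e ∈ J) (f := ℓ) (t := J)
      fun e he => (mem_filter.1 he).2, mul_comm]
    refine card_nsmul_le_sum J _ 2 fun i hi => (hℓ i).trans (card_le_card fun e he => ?_)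
    rw [mem_filter] at he
    rw [mem_filter, mem_filter]
    exact ⟨⟨he.1, he.2 ▸ hi⟩, he.2⟩
  rw [hinj]
  refine (Nat.add_le_add_right hlab _).trans ?_
  rw [← card_union_of_disjoint, ← T.deg_root]
  · refine card_le_card (union_subset (filter_subset _ _) fun e he => ?_)
    obtain ⟨h, hh, rfl⟩ := mem_image.1 he
    exact T.mem_cut_of_anchor (hf h hh)
  · rw [disjoint_left]
    intro e he he'
    obtain ⟨h, hh, rfl⟩ := mem_image.1 he'
    exact hJ _ (mem_filter.1 he).2 h hh _ (hf h hh) rfl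

lemma card_crossing [Fintype V] (t : Setoid A) : (crossing p q S A t).card =
    (anchored p q S A v t).card + (floating p q S A v t).card :=
  (card_filter_add_card_filter_not _).symm

/-- The counting condition needed to pack hypergraphs spanning `A`. -/
lemma packing_condition [Fintype V] (T : Terminal p q S A v L k)
    (ℓ : E → Fin k) (hℓ : ∀ i, 2 ≤ ((cut p q {v}).filter fun e => ℓ e = i).card)
    (hA : ∃ a b : A, a ≠ b) (s : Fin k → Setoid A) (Z : Finset A) :
    ∑ i, Fintype.card (Quotient (s i)) + 2 * k * Z.card ≤
      (univ.filter fun h : E ⊕ V => (∃ i, (∀ e, Anchor p q S A v h e → ℓ e = i) ∧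
        ∃ a ∈ {w : A | (w : V) ∈ span p q S A h}, ∃ b ∈ {w : A | (w : V) ∈ span p q S A h},
          ¬ (s i) a b) ∨ ∃ w ∈ {w : A | (w : V) ∈ span p q S A h}, w ∈ Z).card + k := by
  set count := univ.filter fun h : E ⊕ V => (∃ i, (∀ e, Anchor p q S A v h e → ℓ e = i) ∧
        ∃ a ∈ {w : A | (w : V) ∈ span p q S A h}, ∃ b ∈ {w : A | (w : V) ∈ span p q S A h},
          ¬ (s i) a b) ∨ ∃ w ∈ {w : A | (w : V) ∈ span p q S A h}, w ∈ Z with hcount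
  let t : Setoid A :=
    { r := fun a b => (∀ i, s i a b) ∧ (a = b ∨ (a ∉ Z ∧ b ∉ Z))
      iseqv :=
        { refl := fun a => ⟨fun i => (s i).refl a, Or.inl rfl⟩
          symm := fun h => ⟨fun i => (s i).symm (h.1 i), h.2.imp Eq.symm And.symm⟩
          trans := fun {a b c} h h' => ⟨fun i => (s i).trans (h.1 i) (h'.1 i), by
            rcases h.2 with rfl | h1
            · exact h'.2
            · rcases h'.2 with rfl | h2
              · exact h.2
              · exact Or.inr ⟨h1.1, h2.2⟩⟩ } }
  have ht : ∀ a b, t a b ↔ (∀ i, s i a b) ∧ (a = b ∨ (a ∉ Z ∧ b ∉ Z)) := fun a b => Iff.rfl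
  have hfloat : floating p q S A v t ⊆ count := by
    intro h hh
    obtain ⟨hc, hno⟩ := mem_filter.1 hh
    obtain ⟨a, b, ha, hb, hab⟩ := (mem_filter.1 hc).2
    refine mem_filter.2 ⟨mem_univ _, ?_⟩
    by_cases hs : ∃ i, ¬ s i a b
    · obtain ⟨i, hi⟩ := hs
      exact Or.inl ⟨i, fun e he => absurd ⟨e, he⟩ hno, a, ha, b, hb, hi⟩
    · push Not at hs
      right
      by_cases haZ : a ∈ Z
      · exact ⟨a, ha, haZ⟩
      · refine ⟨b, hb, ?_⟩
        by_contra hbZ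
        exact hab ((ht a b).2 ⟨hs, Or.inr ⟨haZ, hbZ⟩⟩)
  have hquot : ∀ i, Fintype.card (Quotient (s i)) ≤ Fintype.card (Quotient t) := by
    intro i
    refine Fintype.card_le_of_surjective (Quotient.map id fun a b h => h.1 i) fun x => ?_
    obtain ⟨a, rfl⟩ := Quotient.exists_rep x
    exact ⟨Quotient.mk t a, rfl⟩
  have hZ : Z.card ≤ Fintype.card (Quotient t) := by
    rw [← Fintype.card_coe]
    refine Fintype.card_le_of_injective (fun z : Z => Quotient.mk t z.1) fun y z hyz => ?_
    rcases (Quotient.exact hyz : t _ _).2 with h | h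
    · exact Subtype.ext h
    · exact absurd y.2 h.1
  obtain ⟨hmL, hmain, hor⟩ := T.card_quotient_mul_le t
  have hbig := T.big
  have hsum : ∑ i, Fintype.card (Quotient (s i)) ≤ k * Fintype.card (Quotient t) := by
    refine (sum_le_card_nsmul _ _ _ fun i _ => hquot i).trans ?_
    simp
  have hle := card_le_card hfloat
  have hZ' := Nat.mul_le_mul_left (2 * k) hZ
  obtain ⟨a₀, b₀, hab₀⟩ := hA
  generalize hP : Fintype.card (Quotient t) = P at *
  rcases P with _ | _ | _ | n
  · exact absurd (Fintype.card_eq_zero_iff.1 hP) fun h => h.false (Quotient.mk t a₀)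
  · have hall : ∀ a b, t a b := fun a b =>
      Quotient.exact ((Fintype.card_le_one_iff).1 hP.le (Quotient.mk t a) (Quotient.mk t b))
    have : Z = ∅ := by
      rw [eq_empty_iff_forall_notMem]
      intro z hz
      have h1 : ∀ a, z = a := fun a => by
        rcases (hall z a).2 with h | h
        · exact h
        · exact absurd hz h.1
      exact hab₀ ((h1 a₀).symm.trans (h1 b₀))
    subst this
    simp only [card_empty]
    omega
  · have htwo : ∀ a b c, ¬ t a b → t c a ∨ t c b := by
      intro a b c hab
      by_contra hno
      push Not at hno
      have : 2 < Fintype.card (Quotient t) := by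
        rw [Fintype.two_lt_card_iff]
        exact ⟨Quotient.mk t c, Quotient.mk t a, Quotient.mk t b, fun h => hno.1 (Quotient.exact h),
          fun h => hno.2 (Quotient.exact h), fun h => hab (Quotient.exact h)⟩
      omega
    by_cases hZe : Z = ∅
    · subst hZe
      by_cases h16 : 16 * k ≤ (floating p q S A v t).card
      · simp only [card_empty]
        omega
      · have hL := hor.resolve_left h16
        set J := univ.filter fun i => ∃ a b, ¬ s i a b with hJ
        have hsJ : ∑ i, Fintype.card (Quotient (s i)) ≤ k + J.card := by
          have h1 : ∀ i ∈ univ, Fintype.card (Quotient (s i)) ≤ 1 + if i ∈ J then 1 else 0 := by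
            intro i _
            split_ifs with hi
            · exact hquot i
            · refine Fintype.card_le_one_iff.2 fun x y => ?_
              obtain ⟨a, rfl⟩ := Quotient.exists_rep x
              obtain ⟨b, rfl⟩ := Quotient.exists_rep y
              refine Quotient.sound ?_
              by_contra hab
              exact hi (mem_filter.2 ⟨mem_univ _, a, b, hab⟩)
          refine (sum_le_sum h1).trans ?_
          simp [sum_add_distrib]
        set Q : Fin k → E ⊕ V → Prop := fun i h => h ∈ anchored p q S A v t ∧
          ∃ e, Anchor p q S A v h e ∧ ℓ e = i with hQ
        have hJ2 := T.card_anchored_add_le t ℓ hℓ (J.filter fun i => ¬ ∃ h, Q i h) (by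
          intro i hi h hh e he hie
          exact (mem_filter.1 hi).2 ⟨h, hh, e, he, hie⟩)
        have hJsum := card_filter_add_card_filter_not (s := J) fun i => ∃ h, Q i h
        have hchoose : ∀ i ∈ J.filter fun i => ∃ h, Q i h, ∃ h, Q i h :=
          fun i hi => (mem_filter.1 hi).2
        have : Nonempty (E ⊕ V) := ⟨Sum.inr v⟩
        choose! g hg using hchoose
        have hginj : ((J.filter fun i => ∃ h, Q i h).image g).card =
            (J.filter fun i => ∃ h, Q i h).card := by
          refine card_image_of_injOn fun i hi j hj hij => ?_
          obtain ⟨-, e, he, rfl⟩ := hg i hi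
          obtain ⟨-, f, hf, rfl⟩ := hg j hj
          rw [← hij] at hf
          rw [T.anchor_edge_unique he hf]
        have hsub : (J.filter fun i => ∃ h, Q i h).image g ∪ floating p q S A v t ⊆ count := by
          refine union_subset ?_ hfloat
          intro h hh
          obtain ⟨i, hi, rfl⟩ := mem_image.1 hh
          obtain ⟨hanc, e, he, hei⟩ := hg i hi
          obtain ⟨a, b, ha, hb, hab⟩ := (mem_filter.1 (mem_filter.1 hanc).1).2
          refine mem_filter.2 ⟨mem_univ _, Or.inl ⟨i, ?_, a, ha, b, hb, ?_⟩⟩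
          · intro f hf
            rw [← hei, T.anchor_edge_unique he hf]
          · intro hs
            obtain ⟨x, y, hxy⟩ := (mem_filter.1 (mem_filter.1 hi).1).2
            have hto : ∀ c, s i c a := by
              intro c
              rcases htwo a b c hab with h | h
              · exact h.1 i
              · exact (s i).trans (h.1 i) ((s i).symm hs)
            exact hxy ((s i).trans (hto x) ((s i).symm (hto y)))
        have hdisj : Disjoint ((J.filter fun i => ∃ h, Q i h).image g) (floating p q S A v t) := by
          rw [disjoint_left]
          intro h hh hh'
          obtain ⟨i, hi, rfl⟩ := mem_image.1 hh
          obtain ⟨-, e, he, -⟩ := hg i hi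
          exact (mem_filter.1 hh').2 ⟨e, he⟩
        have hfin := card_le_card hsub
        rw [card_union_of_disjoint hdisj, hginj] at hfin
        simp only [card_empty]
        omega
    · obtain ⟨z, hz⟩ := nonempty_iff_ne_empty.2 hZe
      have hcross : crossing p q S A t ⊆ count := by
        intro h hh
        obtain ⟨a, b, ha, hb, hab⟩ := (mem_filter.1 hh).2
        refine mem_filter.2 ⟨mem_univ _, Or.inr ?_⟩
        rcases htwo a b z hab with h | h
        · rcases h.2 with rfl | h
          · exact ⟨z, ha, hz⟩
          · exact absurd hz h.1
        · rcases h.2 with rfl | h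
          · exact ⟨z, hb, hz⟩
          · exact absurd hz h.1
      have h1 := card_le_card hcross
      rw [card_crossing (v := v)] at h1
      omega
  · have h1 := Nat.mul_le_mul_left (n + 1) hbig
    nlinarith

end Terminal

lemma Slack.of_le {E : Type} {k : ℕ} {φ : E → Option (Fin k)} {D : Finset E} {n : ℕ}
    (h : 2 * k ≤ (D.filter fun e => φ e = none).card + n) : Slack φ D n := by
  refine le_trans ?_ h
  refine (sum_le_card_nsmul univ _ 2 fun i _ => Nat.sub_le _ _).trans ?_
  simp [mul_comm]

section

variable {p q : E → V} {S R A : Set V} {v : V} {L k : ℕ} {ℓ : E → Fin k} {c : V → ℕ}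

/-- The hypergraph edge to which `e` belongs. -/
noncomputable def owner (p q : E → V) (S A : Set V) (e : E) : E ⊕ V :=
  if h : ∃ u, u ∉ S ∧ u ∉ A ∧ e ∈ cut p q {u} then Sum.inr h.choose else Sum.inl e

lemma owner_eq_inl {e : E} (h1 : p e ∈ A) (h2 : q e ∈ A) : owner p q S A e = Sum.inl e := by
  refine dif_neg ?_
  rintro ⟨u, -, hu, he⟩
  rcases (mem_cut_singleton.1 he).2 with rfl | rfl
  · exact hu h1
  · exact hu h2

lemma Terminal.owner_eq_inr (T : Terminal p q S A v L k) {e : E} {u x : V} (hu : u ∉ S)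
    (hA : u ∉ A) (hx : x ≠ u) (hj : Joins p q e u x) : owner p q S A e = Sum.inr u := by
  have h : ∃ u, u ∉ S ∧ u ∉ A ∧ e ∈ cut p q {u} := ⟨u, hu, hA, hj.mem_cut_left hx⟩
  rw [owner, dif_pos h]
  have hS := (T.red.neighbor hu hx hj).1
  obtain ⟨h1, h2, h3⟩ := h.choose_spec
  obtain ⟨y, hy, hj'⟩ := exists_joins h3
  generalize h.choose = w at *
  congr 1
  by_contra hne
  have : w = x := by
    rcases hj with ⟨h4, h5⟩ | ⟨h4, h5⟩ <;> rcases hj' with ⟨h6, h7⟩ | ⟨h6, h7⟩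
    · exact absurd (h6.symm.trans h4) hne
    · rw [← h5, h7]
    · rw [← h4, h6]
    · exact absurd (h7.symm.trans h5) hne
  exact h1 (this ▸ hS)

lemma Terminal.exists_owned (T : Terminal p q S A v L k) {h : E ⊕ V} {w : V}
    (hw : w ∈ span p q S A h) :
    ∃ e ∈ cut p q {w}, e ∉ cut p q {v} ∧ owner p q S A e = h := by
  rcases h with e | u
  · obtain ⟨hne, h1, h2, h3⟩ := hw
    refine ⟨e, mem_cut_singleton.2 ⟨hne, by tauto⟩, fun h => ?_, owner_eq_inl h1 h2⟩
    rcases (mem_cut_singleton.1 h).2 with h | h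
    · exact T.root_notMem (h ▸ h1)
    · exact T.root_notMem (h ▸ h2)
  · obtain ⟨hu, hA, hwA, e, hj⟩ := hw
    have hwu : w ≠ u := fun h => hA (h ▸ hwA)
    refine ⟨e, hj.mem_cut_right hwu, fun h => ?_, T.owner_eq_inr hu hA hwu hj⟩
    rcases (mem_cut_singleton.1 h).2 with h | h <;> rcases hj with ⟨h1, h2⟩ | ⟨h1, h2⟩
    · exact hu (h1 ▸ h ▸ T.root)
    · exact T.root_notMem (h ▸ h1 ▸ hwA)
    · exact T.root_notMem (h ▸ h2 ▸ hwA)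
    · exact hu (h2 ▸ h ▸ T.root)

lemma Terminal.eq_of_root_neighbor (T : Terminal p q S A v L k) (hA : ∀ a b : A, a = b) {a x : V}
    (ha : a ∈ A) {e : E} (hx : x ≠ v) (hj : Joins p q e v x) : x = a := by
  by_cases hxA : x ∈ A
  · exact congrArg Subtype.val (hA ⟨x, hxA⟩ ⟨a, ha⟩)
  · exfalso
    have hxS : x ∉ S := fun h => hxA (T.mem_of_mem x h hx)
    rcases T.small x hxS hxA with h | ⟨h3, hs⟩
    · have := hj.mem_cut_right hx
      simp [h] at this
    · have hall : ∀ f ∈ cut p q {x}, Joins p q f x v ∨ Joins p q f x a := by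
        intro f hf
        obtain ⟨y, hy, hjy⟩ := exists_joins hf
        rcases T.eq_or_mem hxS hy hjy with rfl | h
        · exact Or.inl hjy
        · rw [show y = a from congrArg Subtype.val (hA ⟨y, h.1⟩ ⟨a, ha⟩)] at hjy
          exact Or.inr hjy
      obtain ⟨e₁, e₂, e₃, h12, h13, h23, heq⟩ := card_eq_three.1 h3
      have hvx := hx.symm
      have hax : a ≠ x := fun h => hxA (h ▸ ha)
      rcases hall e₁ (by simp [heq]) with h1 | h1 <;> rcases hall e₂ (by simp [heq]) with h2 | h2 <;>
        rcases hall e₃ (by simp [heq]) with h3 | h3 <;>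
        first
        | exact h12 (hs _ _ _ hvx h1 h2)
        | exact h12 (hs _ _ _ hax h1 h2)
        | exact h13 (hs _ _ _ hvx h1 h3)
        | exact h13 (hs _ _ _ hax h1 h3)
        | exact h23 (hs _ _ _ hvx h2 h3)
        | exact h23 (hs _ _ _ hax h2 h3)

lemma ExtData.exists_of_terminal [Fintype V] (h : ExtData p q S R v L k ℓ c)
    (T : Terminal p q S A v L k) (hRA : ∀ r ∈ R, r ∈ A ∨ 2 * k ≤ c r) :
    ∃ φ, IsExt p q S R v ℓ c φ := by
  obtain ⟨a₀, ha₀⟩ : ∃ a, a ∈ A := by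
    obtain ⟨s, hs, hsv⟩ := h.two
    exact ⟨s, T.mem_of_mem s hs hsv⟩
  have hbal : ∀ φ : E → Option (Fin k), (∀ w ∈ A, Slack φ (cut p q {w}) (c w)) →
      ∀ w, w ∈ S ∨ w ∈ R → w ≠ v → Slack φ (cut p q {w}) (c w) := by
    intro φ hφ w hw hwv
    by_cases hwA : w ∈ A
    · exact hφ w hwA
    · refine Slack.of_le ?_
      rcases hw with hw | hw
      · exact absurd (T.mem_of_mem w hw hwv) hwA
      · exact ((hRA w hw).resolve_left hwA).trans (Nat.le_add_left _ _)
  by_cases hone : ∀ a b : A, a = b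
  · have hnb : ∀ e ∈ cut p q {v}, ∀ x, x = p e ∨ x = q e → x ≠ v → x = a₀ := by
      intro e he x hx hxv
      obtain ⟨y, hy, hj⟩ := exists_joins he
      have : x = y := by
        rcases hj with ⟨h1, h2⟩ | ⟨h1, h2⟩ <;> rcases hx with rfl | rfl
        · exact absurd h1 hxv
        · exact h2
        · exact h1
        · exact absurd h2 hxv
      rw [this]
      exact T.eq_of_root_neighbor hone ha₀ hy hj
    refine ⟨fun e => some (ℓ e), fun e _ => rfl, hbal _ fun w hw => ?_, fun i Y _ =>
      ⟨a₀ ∈ Y, fun s hs hsv => ?_, fun e he _ x hx hxv => ?_⟩⟩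
    · have hwa : w = a₀ := congrArg Subtype.val (hone ⟨w, hw⟩ ⟨a₀, ha₀⟩)
      have hsub : cut p q {v} ⊆ cut p q {w} := by
        intro e he
        obtain ⟨y, hy, hj⟩ := exists_joins he
        rw [hwa, ← T.eq_of_root_neighbor hone ha₀ hy hj]
        exact hj.mem_cut_right hy
      rw [Slack, sum_eq_zero]
      · exact Nat.zero_le _
      · intro i _
        have h1 := h.label i
        have h2 := card_le_card (filter_subset_filter (fun e => ℓ e = i) hsub)
        simp only [Option.some.injEq]
        omega
    · rw [show s = a₀ from congrArg Subtype.val (hone ⟨s, T.mem_of_mem s hs hsv⟩ ⟨a₀, ha₀⟩)]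
    · rw [hnb e he x hx hxv]
  · push Not at hone
    have : Nonempty A := ⟨⟨a₀, ha₀⟩⟩
    obtain ⟨g, hcol, hvert, hN, hconn⟩ := exists_hypergraph_packing k (2 * k)
      (fun h : E ⊕ V => {w : A | (w : V) ∈ span p q S A h})
      (fun h i => ∀ e, Anchor p q S A v h e → ℓ e = i)
      (fun s Z => by convert T.packing_condition ℓ h.label hone s Z)
    let γ : E ⊕ V → Option (Fin k) := fun h =>
      if hf : ∃ f, Anchor p q S A v h f then some (ℓ hf.choose) else (g h).bind Sum.getLeft?
    let φ : E → Option (Fin k) := fun e =>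
      if e ∈ cut p q {v} then some (ℓ e)
      else if ∃ w : A, g (owner p q S A e) = some (Sum.inr w) ∧ e ∈ cut p q {(w : V)} then none
      else γ (owner p q S A e)
    have hφroot : ∀ e ∈ cut p q {v}, φ e = some (ℓ e) := fun e he => if_pos he
    have hφnone : ∀ e (w : A), e ∉ cut p q {v} → g (owner p q S A e) = some (Sum.inr w) →
        e ∈ cut p q {(w : V)} → φ e = none := by
      intro e w h1 h2 h3
      simp only [φ]
      rw [if_neg h1, if_pos ⟨w, h2, h3⟩]
    have hφanchor : ∀ e f, e ∉ cut p q {v} → Anchor p q S A v (owner p q S A e) f →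
        (¬ ∃ w : A, g (owner p q S A e) = some (Sum.inr w) ∧ e ∈ cut p q {(w : V)}) →
        φ e = some (ℓ f) := by
      intro e f h1 h2 h3
      have h4 : ∃ f, Anchor p q S A v (owner p q S A e) f := ⟨f, h2⟩
      simp only [φ, γ]
      rw [if_neg h1, if_neg h3, dif_pos h4, T.anchor_edge_unique h4.choose_spec h2]
    have hφcol : ∀ e i, e ∉ cut p q {v} → g (owner p q S A e) = some (Sum.inl i) →
        φ e = some i := by
      intro e i h1 h2
      have h3 : ¬ ∃ w : A, g (owner p q S A e) = some (Sum.inr w) ∧ e ∈ cut p q {(w : V)} := by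
        rintro ⟨w, hw, -⟩
        rw [h2] at hw
        simp at hw
      by_cases h4 : ∃ f, Anchor p q S A v (owner p q S A e) f
      · obtain ⟨f, hf⟩ := h4
        rw [hφanchor e f h1 hf h3, hcol _ _ h2 f hf]
      · simp only [φ, γ]
        rw [if_neg h1, if_neg h3, dif_neg h4, h2]
        rfl
    refine ⟨φ, hφroot, hbal φ fun w hw => Slack.of_le ?_, fun i Y hY => ?_⟩
    · have hex : ∀ h, g h = some (Sum.inr (⟨w, hw⟩ : A)) →
          ∃ e ∈ cut p q {w}, e ∉ cut p q {v} ∧ owner p q S A e = h :=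
        fun h hh => T.exists_owned (hvert h ⟨w, hw⟩ hh)
      have : Nonempty E := by
        obtain ⟨e, -⟩ := card_pos.1 (T.deg_root ▸ T.red.pos)
        exact ⟨e⟩
      choose! f hf using hex
      refine ((hN ⟨w, hw⟩).trans (card_le_card_of_injOn f ?_ ?_)).trans (Nat.le_add_right _ _)
      · intro h hh
        replace hh : g h = some (Sum.inr (⟨w, hw⟩ : A)) := by simpa using hh
        obtain ⟨h1, h2, h3⟩ := hf h hh
        refine mem_filter.2 ⟨h1, hφnone _ ⟨w, hw⟩ h2 ?_ h1⟩
        rwa [h3]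
      · intro h hh h' hh' heq
        replace hh : g h = some (Sum.inr (⟨w, hw⟩ : A)) := by simpa using hh
        replace hh' : g h' = some (Sum.inr (⟨w, hw⟩ : A)) := by simpa using hh'
        rw [← (hf h hh).2.2, ← (hf h' hh').2.2, heq]
    · have hstep : ∀ e x y, φ e = some i → e ∉ cut p q {v} → x ≠ v → Joins p q e x y →
          (x ∈ Y ↔ y ∈ Y) := by
        intro e x y he hev hx hj
        by_cases hy : y = x
        · rw [hy]
        have hyv : y ≠ v := fun h => hev (h ▸ hj.mem_cut_right hy)
        rcases hj with ⟨rfl, rfl⟩ | ⟨rfl, rfl⟩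
        · exact hY e he hx hyv
        · exact (hY e he hyv hx).symm
      have hall := hconn i {w : A | (w : V) ∈ Y} (by
        intro h hg a ha b hb haY
        change (b : V) ∈ Y
        rcases h with e | u
        · obtain ⟨hne, h1, h2, h3⟩ := ha
          obtain ⟨-, -, -, h4⟩ := hb
          have hpv : p e ≠ v := fun h => T.root_notMem (h ▸ h1)
          have hqv : q e ≠ v := fun h => T.root_notMem (h ▸ h2)
          have h5 := hY e (hφcol e i (fun h => by
            rcases (mem_cut_singleton.1 h).2 with h | h
            · exact hpv h
            · exact hqv h) (by rw [owner_eq_inl h1 h2]; exact hg)) hpv hqv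
          change (a : V) ∈ Y at haY
          rcases h3 with h3 | h3 <;> rcases h4 with h4 | h4 <;> rw [h3] at haY <;> rw [h4] <;> tauto
        · obtain ⟨hu, hA, -, e, hj⟩ := ha
          obtain ⟨-, -, -, f, hj'⟩ := hb
          have huv : u ≠ v := fun h => hu (h ▸ T.root)
          have hgo : ∀ (z : A) e, Joins p q e u z → (u ∈ Y ↔ (z : V) ∈ Y) := by
            intro z e hj
            have hzu : (z : V) ≠ u := fun h => hA (h ▸ z.2)
            have hev : e ∉ cut p q {v} := by
              rw [hj.mem_cut, Set.mem_singleton_iff, Set.mem_singleton_iff, not_not]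
              exact ⟨fun h => absurd h huv, fun h => absurd (h ▸ z.2) T.root_notMem⟩
            exact hstep e u z (hφcol e i hev (by rw [T.owner_eq_inr hu hA hzu hj]; exact hg)) hev
              huv hj
          exact (hgo b f hj').1 ((hgo a e hj).2 haY))
      have hmem : ∀ a ∈ A, (a ∈ Y ↔ a₀ ∈ Y) := fun a ha =>
        ⟨fun h => hall ⟨a, ha⟩ ⟨a₀, ha₀⟩ h, fun h => hall ⟨a₀, ha₀⟩ ⟨a, ha⟩ h⟩
      refine ⟨a₀ ∈ Y, fun s hs hsv => hmem s (T.mem_of_mem s hs hsv), fun e he hei x hx hxv => ?_⟩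
      by_cases hxA : x ∈ A
      · exact hmem x hxA
      have hxS : x ∉ S := fun h => hxA (T.mem_of_mem x h hxv)
      have hj : Joins p q e x v := by
        obtain ⟨y, hy, hj⟩ := exists_joins he
        have : x = y := by
          rcases hj with ⟨h1, h2⟩ | ⟨h1, h2⟩ <;> rcases hx with rfl | rfl
          · exact absurd h1 hxv
          · exact h2
          · exact h1
          · exact absurd h2 hxv
        rw [this]
        exact hj.symm
      have hlab : ℓ e = i := by
        rw [hφroot e he] at hei
        exact Option.some.inj hei
      obtain ⟨h3, hs⟩ := (T.small x hxS hxA).resolve_left fun h => by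
        have := hj.mem_cut_left hxv.symm
        simp [h] at this
      have hanch : Anchor p q S A v (Sum.inr x) e := ⟨x, rfl, hxS, hxA, hj⟩
      have hother : ∀ f ∈ (cut p q {x}).erase e, ∃ y ∈ A, Joins p q f x y := by
        intro f hf
        rw [mem_erase] at hf
        obtain ⟨y, hy, hjy⟩ := exists_joins hf.2
        rcases T.eq_or_mem hxS hy hjy with rfl | h
        · exact absurd (hs _ _ _ hy hjy hj) hf.1
        · exact ⟨y, h.1, hjy⟩
      obtain ⟨f₁, hf₁, f₂, hf₂, hne⟩ := one_lt_card.1 (by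
        rw [card_erase_of_mem (hj.mem_cut_left hxv.symm), h3]
        norm_num : 1 < ((cut p q {x}).erase e).card)
      obtain ⟨y₁, hy₁, hj₁⟩ := hother f₁ hf₁
      obtain ⟨y₂, hy₂, hj₂⟩ := hother f₂ hf₂
      have hgo : ∀ f y, y ∈ A → Joins p q f x y →
          (∃ w : A, g (Sum.inr x) = some (Sum.inr w) ∧ f ∈ cut p q {(w : V)}) ∨
            (x ∈ Y ↔ a₀ ∈ Y) := by
        intro f y hy hjf
        by_cases hw : ∃ w : A, g (Sum.inr x) = some (Sum.inr w) ∧ f ∈ cut p q {(w : V)}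
        · exact Or.inl hw
        · right
          have hyx : y ≠ x := fun h => hxA (h ▸ hy)
          have hyv : y ≠ v := fun h => T.root_notMem (h ▸ hy)
          have hfv : f ∉ cut p q {v} := by
            rw [hjf.mem_cut, Set.mem_singleton_iff, Set.mem_singleton_iff, not_not]
            exact ⟨fun h => absurd h hxv, fun h => absurd h hyv⟩
          have hown := T.owner_eq_inr hxS hxA hyx hjf
          have hφf := hφanchor f e hfv (by rw [hown]; exact hanch) (by rw [hown]; exact hw)
          rw [hlab] at hφf
          exact (hstep f x y hφf hfv hxv hjf).trans (hmem y hy)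
      have hend : ∀ f y (w : A), y ∈ A → Joins p q f x y → f ∈ cut p q {(w : V)} → y = w := by
        intro f y w hy hjf hfw
        rw [hjf.mem_cut, Set.mem_singleton_iff, Set.mem_singleton_iff] at hfw
        have hxw : x ≠ w := fun h => hxA (h ▸ w.2)
        tauto
      rcases hgo f₁ y₁ hy₁ hj₁ with ⟨w, hw, hf₁w⟩ | h1
      · rcases hgo f₂ y₂ hy₂ hj₂ with ⟨w', hw', hf₂w⟩ | h2
        · exfalso
          rw [hw] at hw'
          obtain rfl := Sum.inr.inj (Option.some.inj hw')
          have e1 := hend f₁ y₁ w hy₁ hj₁ hf₁w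
          have e2 := hend f₂ y₂ w hy₂ hj₂ hf₂w
          subst e1
          rw [e2] at hj₂
          exact hne (hs _ _ _ (fun h => hxA (h ▸ hy₁)) hj₁ hj₂)
        · exact h2
      · exact h1

end

/-- Every partition at `v` with all parts of size at least two extends to a packing. -/
theorem exists_isExt [Fintype V] : ∀ (n : ℕ) (p q : E → V) (S R : Set V) (v : V) (L k : ℕ)
    (ℓ : E → Fin k) (c : V → ℕ), (proper p q).card = n → ExtData p q S R v L k ℓ c →
    ∃ φ, IsExt p q S R v ℓ c φ := by
  intro n
  induction n using Nat.strong_induction_on with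
  | _ n ih =>
    intro p q S R v L k ℓ c hn h
    rcases h.exists_or_reduced (fun p q S R v L k ℓ c hlt h =>
      ih _ (hn ▸ hlt) p q S R v L k ℓ c rfl h) with hφ | ⟨hred, hsmall⟩
    · exact hφ
    · refine h.exists_of_terminal (A := {w | (w ∈ S ∧ w ≠ v) ∨ (w ∈ R ∧ c w < 2 * k)}) ?_ ?_
      · refine ⟨hred, h.big, h.root, h.deg_root, fun s hs hsv => Or.inl ⟨hs, hsv⟩, ?_, ?_, ?_⟩
        · rintro (hv | hv)
          · exact hv.2 rfl
          · exact h.disj v hv.1 h.root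
        · rintro r (hr | hr) hrS
          · exact absurd hr.1 hrS
          · have := h.large r hr.1
            omega
        · intro u hu huA
          refine hsmall u hu fun huR => ?_
          by_contra hc
          exact huA (Or.inr ⟨huR, by omega⟩)
      · intro r hr
        by_cases hc : c r < 2 * k
        · exact Or.inl (Or.inr ⟨hr, hc⟩)
        · exact Or.inr (by omega)

end Endgame

section Bridge

open Finset
open scoped Classical

variable {V E : Type} [Fintype E] {ends : E → Sym2 V} {p q : E → V}

omit [Fintype E] in
lemma Step.symm {F : Set E} {a b : V} (h : Step ends F a b) : Step ends F b a := by
  obtain ⟨e, he, hab⟩ := h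
  exact ⟨e, he, by rw [hab, Sym2.eq_swap]⟩

omit [Fintype E] in
lemma Reaches.symm {F : Set E} {a b : V} (h : Reaches ends F a b) : Reaches ends F b a :=
  Relation.ReflTransGen.trans_induction_on (motive := fun {a b} _ => Reaches ends F b a) h
    (fun _ => .refl) (fun h => .single h.symm) fun _ _ h1 h2 => h2.trans h1

omit [Fintype E] in
lemma Reaches.mono {F F' : Set E} (hF : F ⊆ F') {a b : V} (h : Reaches ends F a b) :
    Reaches ends F' a b := by
  induction h with
  | refl => exact .refl
  | tail _ h ih =>
    obtain ⟨e, he, hab⟩ := h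
    exact ih.tail ⟨e, hF he, hab⟩

omit [Fintype E] in
lemma joins_iff (hpq : ∀ e, ends e = s(p e, q e)) {e : E} {x y : V} :
    Joins p q e x y ↔ ends e = s(x, y) := by
  rw [hpq e, Sym2.eq_iff]
  rfl

omit [Fintype E] in
lemma mem_ends_iff (hpq : ∀ e, ends e = s(p e, q e)) {e : E} {x : V} :
    x ∈ ends e ↔ x = p e ∨ x = q e := by
  rw [hpq e, Sym2.mem_iff]

lemma IsWalk.exists_mem_cut (hpq : ∀ e, ends e = s(p e, q e)) {X : Set V} {a b : V} {l : List E}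
    (h : IsWalk ends a b l) (ha : a ∈ X) (hb : b ∉ X) : ∃ e ∈ l, e ∈ cut p q X := by
  induction h with
  | nil v => exact absurd ha hb
  | @cons u w z e l he _ ih =>
    by_cases hw : w ∈ X
    · obtain ⟨f, hf, hfX⟩ := ih hw hb
      exact ⟨f, List.mem_cons_of_mem _ hf, hfX⟩
    · refine ⟨e, List.mem_cons_self, ?_⟩
      rw [((joins_iff hpq).2 he).mem_cut]
      tauto

lemma EdgeConnectedIn.le_card_cut (hpq : ∀ e, ends e = s(p e, q e)) {S X : Set V} {n : ℕ}
    (h : EdgeConnectedIn ends Set.univ S n) (hX : ∃ s ∈ S, s ∈ X) (hX' : ∃ s ∈ S, s ∉ X) :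
    n ≤ (cut p q X).card := by
  obtain ⟨s, hs, hsX⟩ := hX
  obtain ⟨t, ht, htX⟩ := hX'
  obtain ⟨P, hP, hdisj⟩ := h s hs t ht fun h => htX (h ▸ hsX)
  choose f hf hfX using fun i => (hP i).1.exists_mem_cut hpq hsX htX
  have := card_le_card_of_injOn (s := univ) (t := cut p q X) f (fun i _ => hfX i)
    fun i _ j _ hij => by
      by_contra hne
      exact hdisj i j hne _ (hf i) (hij ▸ hf j)
  simpa using this

lemma filter_mem_ends (hpq : ∀ e, ends e = s(p e, q e)) (u : V) :
    (univ.filter fun e => u ∈ ends e) =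
      cut p q {u} ∪ univ.filter fun e => p e = q e ∧ p e = u := by
  ext e
  rw [mem_filter, mem_union, mem_cut_singleton, mem_filter, mem_ends_iff hpq]
  simp only [mem_univ, true_and]
  constructor
  · rintro (rfl | rfl)
    · by_cases h : p e = q e <;> simp [h]
    · by_cases h : p e = q e <;> simp [h]
  · rintro (⟨-, h | h⟩ | ⟨h, h'⟩)
    · exact Or.inl h.symm
    · exact Or.inr h.symm
    · exact Or.inl h'.symm

lemma disjoint_cut_loops (u : V) :
    Disjoint (cut p q {u}) (univ.filter fun e => p e = q e ∧ p e = u) := by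
  rw [disjoint_left]
  intro e he he'
  exact (mem_cut_singleton.1 he).1 (mem_filter.1 he').2.1

lemma deg_eq (hpq : ∀ e, ends e = s(p e, q e)) (u : V) : deg ends u =
    (cut p q {u}).card + (univ.filter fun e => p e = q e ∧ p e = u).card := by
  rw [deg, show incEdges ends u = ↑(univ.filter fun e => u ∈ ends e) by ext; simp [incEdges],
    Set.ncard_coe_finset, filter_mem_ends hpq, card_union_of_disjoint (disjoint_cut_loops u)]

lemma balanceVertex_of_slack (hpq : ∀ e, ends e = s(p e, q e)) {k : ℕ} (hk : 0 < k)
    {φ : E → Option (Fin k)} {u : V}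
    (h : Slack φ (cut p q {u}) (univ.filter fun e => p e = q e ∧ p e = u).card) :
    BalanceVertex ends (fun i => {e | φ e = some i ∧ p e ≠ q e}) u := by
  obtain ⟨D, hD⟩ : ∃ D, D = univ.filter fun e => u ∈ ends e := ⟨_, rfl⟩
  let ψ : E → Option (Fin k) := fun e => if p e = q e then none else φ e
  have hsome : ∀ i, (D.filter fun e => ψ e = some i) =
      (cut p q {u}).filter fun e => φ e = some i := by
    intro i
    ext e
    rw [mem_filter, mem_filter, hD, filter_mem_ends hpq, mem_union, mem_filter]
    by_cases he : p e = q e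
    · simp [ψ, he, mem_cut_singleton]
    · simp [ψ, he]
  have hnone : (D.filter fun e => ψ e = none) = ((cut p q {u}).filter fun e => φ e = none) ∪
      univ.filter fun e => p e = q e ∧ p e = u := by
    ext e
    rw [mem_filter, mem_union, mem_filter, hD, filter_mem_ends hpq, mem_union, mem_filter]
    by_cases he : p e = q e
    · simp [ψ, he, mem_cut_singleton]
    · simp [ψ, he]
  obtain ⟨ℓ, h1, h2⟩ := exists_full_labelling hk D _ ψ rfl (by
    simp only [hsome]
    rw [hnone, card_union_of_disjoint]
    · exact h
    · exact (disjoint_cut_loops u).mono_left (filter_subset _ _))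
  refine ⟨⟨fun i => Set.inter_subset_left, fun i j hij => ?_⟩,
    fun i => {e | e ∈ incEdges ends u ∧ ℓ e = i},
    ⟨⟨fun i e he => he.1, fun i j hij => ?_⟩, ?_, fun i => ?_⟩, fun i => ?_⟩
  · rw [Set.disjoint_left]
    rintro e ⟨-, h3, -⟩ ⟨-, h4, -⟩
    exact hij (Option.some.inj (h3.symm.trans h4))
  · rw [Set.disjoint_left]
    rintro e ⟨-, h3⟩ ⟨-, h4⟩
    exact hij (h3.symm.trans h4)
  · ext e
    simp
  · have h3 : {e | e ∈ incEdges ends u ∧ ℓ e = i} = ↑(D.filter fun e => ℓ e = i) := by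
      ext e
      simp [hD, incEdges]
    change 2 ≤ {e | e ∈ incEdges ends u ∧ ℓ e = i}.ncard
    rw [h3, Set.ncard_coe_finset]
    exact h2 i
  · rintro e ⟨h3, h4, h5⟩
    refine ⟨h3, h1 e i ?_⟩
    simp only [ψ]
    rw [if_neg h5, h4]

lemma IsExt.reaches (hpq : ∀ e, ends e = s(p e, q e)) {S R : Set V} {v : V} {k : ℕ}
    {ℓ : E → Fin k} {c : V → ℕ} {φ : E → Option (Fin k)} (h : IsExt p q S R v ℓ c φ) (i : Fin k)
    {x y : V} (hx : (x ∈ S ∧ x ≠ v) ∨ (x ≠ v ∧ ∃ e, φ e = some i ∧ Joins p q e v x))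
    (hy : (y ∈ S ∧ y ≠ v) ∨ (y ≠ v ∧ ∃ e, φ e = some i ∧ Joins p q e v y)) :
    Reaches ends {e ∈ {e | φ e = some i ∧ p e ≠ q e} | v ∉ ends e} x y := by
  set F := {e ∈ {e | φ e = some i ∧ p e ≠ q e} | v ∉ ends e} with hF
  obtain ⟨β, h1, h2⟩ := h.conn i {z | Reaches ends F x z} (by
    intro e he hp hq
    by_cases hne : p e = q e
    · rw [hne]
    have hstep : Step ends F (p e) (q e) := by
      refine ⟨e, ⟨⟨he, hne⟩, ?_⟩, hpq e⟩
      rw [mem_ends_iff hpq]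
      rintro (h | h)
      · exact hp h.symm
      · exact hq h.symm
    exact ⟨fun h => h.tail hstep, fun h => h.tail hstep.symm⟩)
  have key : ∀ z, ((z ∈ S ∧ z ≠ v) ∨ (z ≠ v ∧ ∃ e, φ e = some i ∧ Joins p q e v z)) →
      (Reaches ends F x z ↔ β) := by
    rintro z (⟨hz, hzv⟩ | ⟨hzv, e, he, hj⟩)
    · exact h1 z hz hzv
    · refine h2 e (hj.mem_cut_left hzv) he z ?_ hzv
      rcases hj with ⟨-, rfl⟩ | ⟨rfl, -⟩
      · exact Or.inr rfl
      · exact Or.inl rfl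
  exact (key y hy).2 ((key x hx).1 Relation.ReflTransGen.refl)

lemma IsExt.not_isCutVertexOf (hpq : ∀ e, ends e = s(p e, q e)) {S R : Set V} {v : V} {k : ℕ}
    {ℓ : E → Fin k} {c : V → ℕ} {φ : E → Option (Fin k)} (h : IsExt p q S R v ℓ c φ) (i : Fin k) :
    ¬ IsCutVertexOf ends {e | φ e = some i ∧ p e ≠ q e} v := by
  rintro ⟨a, b, ha, hb, hab, hno⟩
  set F := {e ∈ {e | φ e = some i ∧ p e ≠ q e} | v ∉ ends e} with hF
  have key : ∀ z, Reaches ends {e | φ e = some i ∧ p e ≠ q e} a z → (z ≠ v → Reaches ends F a z) ∧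
      (z = v → ∃ y, y ≠ v ∧ (∃ e, φ e = some i ∧ Joins p q e v y) ∧ Reaches ends F a y) := by
    intro z hz
    induction hz with
    | refl => exact ⟨fun _ => Relation.ReflTransGen.refl, fun h => absurd h ha⟩
    | @tail y z _ hstep ih =>
      obtain ⟨e, he, hyz⟩ := hstep
      have hj : Joins p q e y z := (joins_iff hpq).2 hyz
      have hne : y ≠ z := by
        rintro rfl
        rcases hj with ⟨h1, h2⟩ | ⟨h1, h2⟩ <;> exact he.2 (h1.trans h2.symm)
      by_cases hyv : y = v
      · refine ⟨fun hzv => ?_, fun hzv => absurd (hyv.trans hzv.symm) hne⟩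
        obtain ⟨w, hwv, hw, haw⟩ := ih.2 hyv
        exact haw.trans (h.reaches hpq i (Or.inr ⟨hwv, hw⟩)
          (Or.inr ⟨hzv, e, he.1, hyv ▸ hj⟩))
      · refine ⟨fun hzv => (ih.1 hyv).tail ⟨e, ⟨he, ?_⟩, hyz⟩, fun hzv =>
          ⟨y, hyv, ⟨e, he.1, hzv ▸ hj.symm⟩, ih.1 hyv⟩⟩
        rw [hyz, Sym2.mem_iff]
        rintro (h | h)
        · exact hyv h.symm
        · exact hzv h.symm
  exact hno ((key b hab).1 hb)

/-- The Extension Theorem. -/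
theorem not_extCex [Fintype V] {Q k : ℕ} {S R : Set V} {v : V} {P : Fin k → Set E} :
    ¬ ExtCex Q k ends S R v P := by
  rintro ⟨hQ, hk, hSR, hS, hconn, hR, hvS, hloop, hdeg, ⟨-, P', ⟨⟨hinc, hdisj⟩, hcover, htwo⟩, hPP'⟩,
    -, hno⟩
  obtain ⟨p, q, hpq⟩ : ∃ p q : E → V, ∀ e, ends e = s(p e, q e) := by
    have : ∀ e, ∃ x y, ends e = s(x, y) := fun e => (ends e).ind fun x y => ⟨x, y, rfl⟩
    choose p q h using this
    exact ⟨p, q, h⟩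
  have hroot : ∀ e, e ∈ incEdges ends v ↔ e ∈ cut p q {v} := by
    intro e
    rw [mem_cut_singleton]
    constructor
    · intro he
      have h1 := hloop e he
      rw [hpq e, Sym2.mk_isDiag_iff] at h1
      refine ⟨h1, ?_⟩
      rcases (mem_ends_iff hpq).1 he with h | h
      · exact Or.inl h.symm
      · exact Or.inr h.symm
    · rintro ⟨-, h | h⟩
      · exact (mem_ends_iff hpq).2 (Or.inl h.symm)
      · exact (mem_ends_iff hpq).2 (Or.inr h.symm)
  have hlab : ∀ e, ∃ i, e ∈ incEdges ends v → e ∈ P' i := by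
    intro e
    by_cases he : e ∈ incEdges ends v
    · obtain ⟨i, hi⟩ := Set.mem_iUnion.1 (hcover ▸ he)
      exact ⟨i, fun _ => hi⟩
    · exact ⟨⟨0, hk⟩, fun h => absurd h he⟩
  choose ℓ hℓ using hlab
  have hℓ_iff : ∀ e ∈ incEdges ends v, ∀ i, e ∈ P' i ↔ ℓ e = i := by
    intro e he i
    refine ⟨fun h => ?_, fun h => h ▸ hℓ e he⟩
    by_contra hne
    exact Set.disjoint_left.1 (hdisj _ _ hne) (hℓ e he) h
  have hlabel : ∀ i, 2 ≤ ((cut p q {v}).filter fun e => ℓ e = i).card := by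
    intro i
    refine (htwo i).trans ?_
    rw [← Set.ncard_coe_finset]
    refine Set.ncard_le_ncard fun e he => ?_
    have he' := hinc i he
    rw [mem_coe, mem_filter]
    exact ⟨(hroot e).1 he', (hℓ_iff e he' i).1 he⟩
  have hdata : ExtData p q S R v (Q * k) k ℓ
      fun u => (univ.filter fun e => p e = q e ∧ p e = u).card := by
    refine ⟨hk, Nat.mul_le_mul_right k hQ, hvS, ?_, fun X => hconn.le_card_cut hpq, ?_, hlabel,
      fun r hr hrS => Set.disjoint_left.1 hSR hrS hr, fun r hr => ?_⟩
    · obtain ⟨s, hs, hsv⟩ := Set.exists_ne_of_one_lt_ncard hS v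
      exact ⟨s, hs, hsv⟩
    · rw [← hdeg, deg, ← Set.ncard_coe_finset]
      congr 1
      ext e
      exact (hroot e).symm
    · have h1 := hR r hr
      rw [deg_eq hpq, Nat.sub_mul] at h1
      omega
  obtain ⟨φ, hφ⟩ := exists_isExt _ p q S R v (Q * k) k ℓ _ rfl hdata
  have hsub : ∀ i, P' i ⊆ {e | φ e = some i ∧ p e ≠ q e} := by
    intro i e he
    have he' := hinc i he
    have hc := (hroot e).1 he'
    exact ⟨by rw [hφ.root e hc, (hℓ_iff e he' i).1 he], (mem_cut_singleton.1 hc).1⟩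
  refine hno ⟨fun i => {e | φ e = some i ∧ p e ≠ q e}, fun i j hij => ?_, fun i => ?_, fun u hu => ?_,
    fun i => ⟨(hPP' i).trans (hsub i), hφ.not_isCutVertexOf hpq i⟩⟩
  · rw [Set.disjoint_left]
    rintro e ⟨h1, -⟩ ⟨h2, -⟩
    exact hij (Option.some.inj (h1.symm.trans h2))
  · obtain ⟨e, he⟩ := card_pos.1 (lt_of_lt_of_le (by norm_num) (hlabel i))
    obtain ⟨hev, hei⟩ := mem_filter.1 he
    obtain ⟨y, hyv, hj⟩ := exists_joins hev
    have hei' : φ e = some i := by rw [hφ.root e hev, hei]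
    have hall : ∀ a ∈ S, Reaches ends {e | φ e = some i ∧ p e ≠ q e} y a := by
      intro a ha
      by_cases hav : a = v
      · refine Relation.ReflTransGen.single ⟨e, ⟨hei', (mem_cut_singleton.1 hev).1⟩, ?_⟩
        rw [hav]
        exact (joins_iff hpq).1 hj.symm
      · exact (hφ.reaches hpq i (Or.inr ⟨hyv, e, hei', hj⟩) (Or.inl ⟨ha, hav⟩)).mono
          (Set.sep_subset _ _)
    exact fun a ha b hb => (hall a ha).symm.trans (hall b hb)
  · by_cases huv : u = v
    · subst huv
      refine ⟨⟨fun i => Set.inter_subset_left, fun i j hij => ?_⟩, P', ⟨⟨hinc, hdisj⟩, hcover, htwo⟩,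
        fun i => ?_⟩
      · rw [Set.disjoint_left]
        rintro e ⟨-, h1, -⟩ ⟨-, h2, -⟩
        exact hij (Option.some.inj (h1.symm.trans h2))
      · rintro e ⟨he, h1, -⟩
        rw [hφ.root e ((hroot e).1 he)] at h1
        exact (hℓ_iff e he i).2 (Option.some.inj h1)
    · exact balanceVertex_of_slack hpq hk (hφ.balance u hu huv)

end Bridge

/-- In a minimal counterexample to the Extension Theorem,
every vertex `u ∈ V(G) − S − R` has degree `3` and is adjacent to exactly `3`
distinct vertices. -/
theorem min_cex_degree_three {V E : Type} [Fintype V] [Fintype E]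
    (Q k : ℕ) (ends : E → Sym2 V) (S R : Set V) (v : V) (P : Fin k → Set E)
    (h : MinExtCex Q k ends S R v P) :
    ∀ u : V, u ∉ S → u ∉ R →
      deg ends u = 3 ∧ (neighbors ends u).ncard = 3 := by
  exact absurd h.1 not_extCex

end SteinerPacking
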